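/- arXiv:math/0312020 — 2 statements merged into one kernel-verified Lean document; each statement's English description precedes it below -/
import Mathlib

section
/- Fix r ≥ 1. There is a shape datum for partitions under the horizontal r-ribbon strip relation with entries in ℕʳ: for every pair of partitions μ, ν (in the same r-rim hook lattice component), there is a bijection b_{μ,ν} from partitions κ with μ ≤ʰᵣ κ ≥ʰᵣ ν to pairs (a, λ) with a ∈ ℕʳ and μ ≥ʰᵣ λ ≤ʰᵣ ν, determined by the condition that (edge(λ), edge(μ), edge(ν), edge(κ), a, 0) is a basic square configuration. Whenever (a, λ) = b_{μ,ν}(κ), one has |κ/μ|_r − |ν/λ|_r = |a| and spin(κ/μ) + spin(κ/ν) = spin(μ/λ) + spin(ν/λ) + Σ_{i=0}^{r−1} i·a_i. -/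
open scoped Classical

/-- A doubly infinite bit sequence: a function `ℤ → ℕ` with all values `≤ 1`. -/
def IsBitSeq (s : ℤ → ℕ) : Prop := ∀ i, s i ≤ 1

/-- The quadruple `(w (i-r), t (i-r), s i, w i)` equals `(1,0,0,1)`:
the strip `t/s` with witness `w` has an `r`-ribbon at position `i`. -/
def Quad (r : ℕ) (s t w : ℤ → ℕ) (i : ℤ) : Prop :=
  w (i - r) = 1 ∧ t (i - r) = 0 ∧ s i = 0 ∧ w i = 1

/-- `w` is a witness for `t/s` being a horizontal `r`-ribbon strip: for every `i`, the
quadruple `(w (i-r), t (i-r), s i, w i)` is of the form `(a,a,b,b)` or equals `(1,0,0,1)`,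
the latter happening only finitely often. -/
def IsWitness (r : ℕ) (s t w : ℤ → ℕ) : Prop :=
  (∀ i : ℤ, (w (i - r) = t (i - r) ∧ s i = w i) ∨ Quad r s t w i) ∧
    {i : ℤ | Quad r s t w i}.Finite

/-- `t/s` is a horizontal `r`-ribbon strip (`s ≤ʰᵣ t`). -/
def HStrip (r : ℕ) (s t : ℤ → ℕ) : Prop := ∃ w, IsWitness r s t w

/-- The height `∑_{j=1}^{r-1} w (i - j)` of a ribbon at position `i` read off from `w`. -/
def hgtAt (r : ℕ) (w : ℤ → ℕ) (i : ℤ) : ℕ := ∑ j ∈ Finset.Ico 1 r, w (i - (j : ℤ))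

/-- The witness of a horizontal `r`-ribbon strip (it is unique). -/
noncomputable def theWitness (r : ℕ) (s t : ℤ → ℕ) : ℤ → ℕ :=
  if h : HStrip r s t then h.choose else s

/-- The strip `t/s` has a ribbon at position (head diagonal) `i`. -/
def RibbonAt (r : ℕ) (s t : ℤ → ℕ) (i : ℤ) : Prop :=
  Quad r s t (theWitness r s t) i

/-- The number of `r`-ribbons of the strip `t/s`. -/
noncomputable def ribCount (r : ℕ) (s t : ℤ → ℕ) : ℕ :=
  {i : ℤ | RibbonAt r s t i}.ncard

/-- Twice the spin of the horizontal `r`-ribbon strip `t/s`: the total height of the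
ribbons of its standardisation. -/
noncomputable def twoSpin (r : ℕ) (s t : ℤ → ℕ) : ℕ :=
  ∑ᶠ i ∈ {i : ℤ | RibbonAt r s t i}, hgtAt r (theWitness r s t) i

/-- A partition: a weakly decreasing, eventually zero function `ℕ → ℕ`. -/
def IsPartition (f : ℕ → ℕ) : Prop :=
  (∀ i j : ℕ, i ≤ j → f j ≤ f i) ∧ ∃ N : ℕ, ∀ n : ℕ, N ≤ n → f n = 0

/-- The edge sequence of a partition: bit `1` exactly at the positions `f j - j - 1`
(for `j : ℕ`); it is eventually `1` to the left and `0` to the right, and adding a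
square on diagonal `k` replaces the substring `10` at positions `(k-1, k)` by `01`. -/
noncomputable def edgeSeq (f : ℕ → ℕ) (k : ℤ) : ℕ :=
  if ∃ j : ℕ, (f j : ℤ) - (j : ℤ) - 1 = k then 1 else 0

/-- A vector in `ℕ^r`, encoded as a function `ℕ → ℕ` supported on `{0, …, r-1}`. -/
def Supported (r : ℕ) (a : ℕ → ℕ) : Prop := ∀ h : ℕ, r ≤ h → a h = 0

/-- Basic square configuration `((l m // n k), aL, aG)` (Definition of the paper):
all five skew shapes are horizontal `r`-ribbon strips, and with `w` the witness for
`l ≤ʰᵣ k` there is a map `a : ℤ → ℕ → ℕ` satisfying conditions (0)–(4). -/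
def IsBSC (r : ℕ) (l m n k : ℤ → ℕ) (aL aG : ℕ → ℕ) : Prop :=
  HStrip r l m ∧ HStrip r l n ∧ HStrip r m k ∧ HStrip r n k ∧ HStrip r l k ∧
  ∀ w, IsWitness r l k w →
    ∃ a : ℤ → ℕ → ℕ, ∀ i : ℤ,
      (¬ Quad r l k w i → a i = a (i + 1)) ∧
      (w (i - r) ≠ w i → a i (hgtAt r w i) = 0) ∧
      (Quad r l k w i → RibbonAt r l m i → RibbonAt r l n i →
        a (i + 1) = fun h => a i h + (if h = hgtAt r w i then 1 else 0)) ∧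
      (Quad r l k w i → RibbonAt r m k i → RibbonAt r n k i →
        a i = fun h => a (i + 1) h + (if h = hgtAt r w i then 1 else 0)) ∧
      (Quad r l k w i → ¬ (RibbonAt r l m i ∧ RibbonAt r l n i) →
        ¬ (RibbonAt r m k i ∧ RibbonAt r n k i) → a i = a (i + 1)) ∧
      ((∀ j : ℤ, j < i → ¬ Quad r l k w j) → a i = aL) ∧
      ((∀ j : ℤ, i ≤ j → ¬ Quad r l k w j) → a i = aG)

/-- The indicator function of a set of integers. -/
noncomputable def ind (R : Set ℤ) (i : ℤ) : ℕ := if i ∈ R then 1 else 0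

lemma ind_of_mem {R : Set ℤ} {i : ℤ} (h : i ∈ R) : ind R i = 1 := if_pos h

lemma ind_of_notMem {R : Set ℤ} {i : ℤ} (h : i ∉ R) : ind R i = 0 := if_neg h

lemma ind_le_one (R : Set ℤ) (i : ℤ) : ind R i ≤ 1 := by
  unfold ind; split_ifs <;> simp

lemma ind_eq_one {R : Set ℤ} {i : ℤ} : ind R i = 1 ↔ i ∈ R := by
  unfold ind; split_ifs <;> simp_all

lemma ind_diff_add {R A : Set ℤ} (h : A ⊆ R) (i : ℤ) : ind (R \ A) i + ind A i = ind R i := by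
  unfold ind
  by_cases hA : i ∈ A
  · simp [hA, h hA]
  · simp [hA]

/-- The sequence `t` arises from `s` by moving ribbons with head positions `R`. -/
structure RibbonSet (r : ℕ) (s t : ℤ → ℕ) (R : Set ℤ) : Prop where
  finite : R.Finite
  balance : ∀ i, t i + ind R (i + r) = s i + ind R i
  head : ∀ i ∈ R, s i = 0
  tail : ∀ i ∈ R, t (i - r) = 0

/-- The witness attached to a lower sequence and a set of ribbon positions. -/
noncomputable def wit (s : ℤ → ℕ) (R : Set ℤ) (i : ℤ) : ℕ := s i + ind R i

namespace RibbonSet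

variable {r : ℕ} {s t u : ℤ → ℕ} {R A C : Set ℤ}

lemma wit_sub (h : RibbonSet r s t R) (i : ℤ) : wit s R (i - r) = t (i - r) + ind R i := by
  have := h.balance (i - r)
  rw [sub_add_cancel] at this
  exact this.symm

lemma quad_iff (h : RibbonSet r s t R) (i : ℤ) : Quad r s t (wit s R) i ↔ i ∈ R := by
  constructor
  · rintro ⟨-, -, h3, h4⟩
    unfold wit at h4
    rw [h3, zero_add] at h4
    exact ind_eq_one.1 h4
  · intro hi
    refine ⟨?_, h.tail i hi, h.head i hi, ?_⟩
    · rw [h.wit_sub, h.tail i hi, ind_of_mem hi]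
    · simp [wit, h.head i hi, ind_of_mem hi]

lemma isWitness (h : RibbonSet r s t R) : IsWitness r s t (wit s R) := by
  constructor
  · intro i
    by_cases hi : i ∈ R
    · exact Or.inr ((h.quad_iff i).2 hi)
    · left
      rw [h.wit_sub]
      simp [wit, ind_of_notMem hi]
  · convert h.finite using 1
    ext i
    exact h.quad_iff i

lemma hStrip (h : RibbonSet r s t R) : HStrip r s t := ⟨_, h.isWitness⟩

end RibbonSet

lemma IsWitness.ribbonSet {r : ℕ} {s t w : ℤ → ℕ} (h : IsWitness r s t w) :
    RibbonSet r s t {i | Quad r s t w i} ∧ w = wit s {i | Quad r s t w i} := by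
  have hw : ∀ i, w i = s i + ind {i | Quad r s t w i} i := by
    intro i
    by_cases hi : Quad r s t w i
    · rw [ind_of_mem hi, hi.2.2.1, hi.2.2.2]
    · rw [ind_of_notMem hi]
      have := (h.1 i).resolve_right hi
      omega
  refine ⟨⟨h.2, fun i => ?_, fun i hi => hi.2.2.1, fun i hi => hi.2.1⟩, funext hw⟩
  rw [← hw]
  by_cases hi : Quad r s t w (i + r)
  · rw [ind_of_mem hi]
    have h1 := hi.1
    have h2 := hi.2.1
    rw [add_sub_cancel_right] at h1 h2
    omega
  · rw [ind_of_notMem hi]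
    have := ((h.1 (i + r)).resolve_right hi).1
    rw [add_sub_cancel_right] at this
    omega

lemma HStrip.exists_ribbonSet {r : ℕ} {s t : ℤ → ℕ} (h : HStrip r s t) :
    ∃ R, RibbonSet r s t R :=
  ⟨_, h.choose_spec.ribbonSet.1⟩

lemma eq_zero_of_periodic_of_finite {r : ℕ} (hr : 1 ≤ r) {f : ℤ → ℤ}
    (hf : {i | f i ≠ 0}.Finite) (hp : ∀ i, f (i + r) = f i) (i : ℤ) : f i = 0 := by
  by_contra hi
  have key : ∀ n : ℕ, f (i + n * r) = f i := by
    intro n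
    induction n with
    | zero => simp
    | succ n ih => rw [← ih, ← hp (i + n * r)]; congr 1; push_cast; ring
  refine Set.not_injOn_infinite_finite_image (f := fun n : ℕ => i + n * r) (s := Set.univ)
    Set.infinite_univ (hf.subset ?_) ?_
  · rintro _ ⟨n, -, rfl⟩
    simpa [key] using hi
  · intro a _ b _ hab
    have : (a : ℤ) * r = b * r := by simpa using hab
    have hr' : (r : ℤ) ≠ 0 := by omega
    exact_mod_cast mul_right_cancel₀ hr' this

namespace RibbonSet

variable {r : ℕ} {s t u : ℤ → ℕ} {R A C : Set ℤ}

lemma ind_add (hr : 1 ≤ r) (hA : RibbonSet r s t A) (hC : RibbonSet r t u C)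
    (hR : RibbonSet r s u R) (i : ℤ) : ind A i + ind C i = ind R i := by
  have := eq_zero_of_periodic_of_finite hr
    (f := fun i => (ind A i : ℤ) + ind C i - ind R i) ?_ ?_ i
  · omega
  · refine ((hA.finite.union hC.finite).union hR.finite).subset fun j hj => ?_
    by_contra hj'
    simp only [Set.mem_union, not_or] at hj'
    exact hj (by simp [ind_of_notMem hj'.1.1, ind_of_notMem hj'.1.2, ind_of_notMem hj'.2])
  · intro j
    have h1 := hA.balance j
    have h2 := hC.balance j
    have h3 := hR.balance j
    omega

lemma refl_empty (r : ℕ) (s : ℤ → ℕ) : RibbonSet r s s ∅ :=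
  ⟨Set.finite_empty, by simp [ind], by simp, by simp⟩

lemma subset_and_eq_diff (hr : 1 ≤ r) (hA : RibbonSet r s t A) (hC : RibbonSet r t u C)
    (hR : RibbonSet r s u R) : A ⊆ R ∧ C = R \ A := by
  have h := ind_add hr hA hC hR
  constructor
  · intro i hi
    have := h i
    rw [ind_of_mem hi] at this
    have h1 := ind_le_one R i
    exact ind_eq_one.1 (by omega)
  · ext i
    have h1 := h i
    have h2 := ind_le_one R i
    simp only [Set.mem_sdiff, ← ind_eq_one]
    omega

lemma unique (hr : 1 ≤ r) (hA : RibbonSet r s t A) (hR : RibbonSet r s t R) : A = R := by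
  have := (subset_and_eq_diff hr (refl_empty r s) hA hR).2
  simpa using this

lemma diff_of_subset (hA : RibbonSet r s t A) (hR : RibbonSet r s u R) (h : A ⊆ R) :
    RibbonSet r t u (R \ A) := by
  refine ⟨hR.finite.sdiff, fun i => ?_, fun i hi => ?_, fun i hi => hR.tail i hi.1⟩
  · have h1 := hA.balance i
    have h2 := hR.balance i
    have h3 := ind_diff_add h i
    have h4 := ind_diff_add h (i + r)
    omega
  · have h1 := hA.balance i
    have h2 := hR.head i hi.1
    rw [h2, ind_of_notMem hi.2] at h1
    omega

lemma theWitness_eq (hr : 1 ≤ r) (h : RibbonSet r s t R) : theWitness r s t = wit s R := by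
  unfold theWitness
  rw [dif_pos h.hStrip]
  have := h.hStrip.choose_spec.ribbonSet
  rw [unique hr this.1 h] at this
  exact this.2

lemma ribbonAt_iff (hr : 1 ≤ r) (h : RibbonSet r s t R) (i : ℤ) : RibbonAt r s t i ↔ i ∈ R := by
  unfold RibbonAt
  rw [h.theWitness_eq hr, h.quad_iff]

lemma ribCount_eq (hr : 1 ≤ r) (h : RibbonSet r s t R) : ribCount r s t = R.ncard := by
  unfold ribCount
  congr 1
  ext i
  exact h.ribbonAt_iff hr i

lemma twoSpin_eq (hr : 1 ≤ r) (h : RibbonSet r s t R) :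
    twoSpin r s t = ∑ i ∈ h.finite.toFinset, hgtAt r (wit s R) i := by
  have h1 : {i : ℤ | RibbonAt r s t i} = ↑h.finite.toFinset := by
    ext i
    simp [h.ribbonAt_iff hr i]
  unfold twoSpin
  rw [h1, h.theWitness_eq hr, finsum_mem_coe_finset]

/-- Reversing the direction of both sequences interchanges the lower and the upper one. -/
lemma reflect (h : RibbonSet r s t R) :
    RibbonSet r (fun i => t (-i)) (fun i => s (-i)) {i | (r : ℤ) - i ∈ R} := by
  refine ⟨h.finite.preimage (fun a _ b _ hab => by simpa using hab), fun i => ?_,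
    fun i hi => ?_, fun i hi => ?_⟩
  · have := h.balance (-i)
    have e1 : ind {i | (r : ℤ) - i ∈ R} (i + r) = ind R (-i) := by
      simp only [ind, Set.mem_ofPred_eq]; congr 2; ring
    have e2 : ind {i | (r : ℤ) - i ∈ R} i = ind R (-i + r) := by
      simp only [ind, Set.mem_ofPred_eq]; congr 2; ring
    rw [e1, e2]
    omega
  · have := h.tail _ hi
    rwa [show (r : ℤ) - i - r = -i by ring] at this
  · have := h.head _ hi
    rwa [show (r : ℤ) - i = -(i - r) by ring] at this

end RibbonSet

/-- The local rules of a basic square configuration whose smallest sequence is `x`: the strips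
from `x` to the two middle sequences have ribbon positions `A` and `B`, the strip to the largest
sequence has ribbon positions `R`, and `a` is the value map. -/
structure LocalRules (r : ℕ) (x : ℤ → ℕ) (A B R : Set ℤ) (a : ℤ → ℕ → ℕ) : Prop where
  finite : R.Finite
  subset_left : A ⊆ R
  subset_right : B ⊆ R
  head : ∀ i ∈ R, x i = 0
  tail : ∀ i ∈ R, wit x R (i - r) = 1
  still : ∀ i, i ∉ R → a i = a (i + 1)
  vanish : ∀ i, wit x R (i - r) ≠ wit x R i → a i (hgtAt r (wit x R) i) = 0
  gain : ∀ i, i ∈ A → i ∈ B →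
    a (i + 1) = fun h => a i h + (if h = hgtAt r (wit x R) i then 1 else 0)
  loss : ∀ i, i ∈ R → i ∉ A → i ∉ B →
    a i = fun h => a (i + 1) h + (if h = hgtAt r (wit x R) i then 1 else 0)
  mixed : ∀ i, i ∈ R → (i ∈ A ↔ i ∉ B) → a i = a (i + 1)

lemma hgtAt_congr {r : ℕ} {w w' : ℤ → ℕ} {i : ℤ} (h : ∀ j < i, w j = w' j) :
    hgtAt r w i = hgtAt r w' i := by
  unfold hgtAt
  refine Finset.sum_congr rfl fun j hj => h _ ?_
  rw [Finset.mem_Ico] at hj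
  omega

lemma hgtAt_le {r : ℕ} {w : ℤ → ℕ} (hw : ∀ j, w j ≤ 1) (i : ℤ) : hgtAt r w i ≤ r - 1 := by
  unfold hgtAt
  calc _ ≤ ∑ j ∈ Finset.Ico 1 r, 1 := Finset.sum_le_sum fun j _ => hw _
    _ = r - 1 := by simp

lemma hgtAt_reflect (r : ℕ) (w : ℤ → ℕ) (i : ℤ) :
    hgtAt r (fun j => w (-j)) (r - i) = hgtAt r w i := by
  unfold hgtAt
  refine Finset.sum_nbij' (fun j => r - j) (fun j => r - j) ?_ ?_ ?_ ?_ ?_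
  · intro j hj; rw [Finset.mem_Ico] at hj ⊢; omega
  · intro j hj; rw [Finset.mem_Ico] at hj ⊢; omega
  · intro j hj; rw [Finset.mem_Ico] at hj; omega
  · intro j hj; rw [Finset.mem_Ico] at hj; omega
  · intro j hj; rw [Finset.mem_Ico] at hj; 
    rw [Nat.cast_sub hj.2.le]
    exact congrArg w (by ring)

lemma hgtAt_succ_eq {r : ℕ} (hr : 1 ≤ r) (w : ℤ → ℕ) (i : ℤ) :
    hgtAt (r + 1) w i = hgtAt r w i + w (i - r) := by
  unfold hgtAt
  rw [Finset.sum_Ico_succ_top hr]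

lemma hgtAt_succ_succ {r : ℕ} (w : ℤ → ℕ) (i : ℤ) (hr : 1 ≤ r) :
    hgtAt (r + 1) w (i + 1) = w i + hgtAt r w i := by
  unfold hgtAt
  rw [Finset.sum_eq_sum_Ico_succ_bot (by omega)]
  congr 1
  · congr 1; push_cast; ring
  · rw [← Finset.sum_Ico_add' _ 1 r 1]
    refine Finset.sum_congr rfl fun j _ => ?_
    congr 1; push_cast; ring

namespace LocalRules

variable {r : ℕ} {x k : ℤ → ℕ} {A B R R' : Set ℤ} {a a' : ℤ → ℕ → ℕ}

lemma reflect (h : LocalRules r x A B R a) (hk : RibbonSet r x k R) :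
    LocalRules r (fun i => k (-i)) {i | (r : ℤ) - i ∈ R \ A} {i | (r : ℤ) - i ∈ R \ B}
      {i | (r : ℤ) - i ∈ R} (fun j => a (r - j + 1)) := by
  have hw : wit (fun i => k (-i)) {i | (r : ℤ) - i ∈ R} = fun j => wit x R (-j) := by
    funext j
    have := hk.wit_sub (r - j)
    rw [show (r : ℤ) - j - r = -j by ring] at this
    rw [this]
    rfl
  have hg : ∀ j, hgtAt r (fun j => wit x R (-j)) j = hgtAt r (wit x R) (r - j) := by
    intro j
    rw [← hgtAt_reflect]
    simp only [neg_neg]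
  have e : ∀ j : ℤ, (r : ℤ) - (j + 1) + 1 = r - j := fun j => by ring
  refine ⟨h.finite.preimage (fun a _ b _ hab => by simpa using hab), fun i hi => hi.1,
    fun i hi => hi.1, ?_, ?_, ?_, ?_, ?_, ?_, ?_⟩
  · intro i hi
    have := hk.tail _ hi
    rwa [show (r : ℤ) - i - r = -i by ring] at this
  · intro i hi
    rw [hw]
    have hi' : (r : ℤ) - i ∈ R := hi
    simp only [neg_sub]
    rw [wit, h.head _ hi', ind_of_mem hi']
  · intro i hi
    simp only [e]
    exact (h.still _ hi).symm
  · intro i hi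
    rw [hw] at hi ⊢
    rw [hg]
    simp only [neg_sub] at hi
    rw [show -i = (r : ℤ) - i - r by ring] at hi
    have hR : (r : ℤ) - i ∉ R := fun hR => hi (by
      rw [h.tail _ hR, wit, h.head _ hR, ind_of_mem hR])
    rw [← h.still _ hR]
    exact h.vanish _ hi.symm
  · intro i hA hB
    simp only [hw, hg, e]
    exact h.loss _ hA.1 hA.2 hB.2
  · intro i hi hA hB
    simp only [hw, hg, e]
    refine h.gain _ ?_ ?_
    · by_contra hc; exact hA ⟨hi, hc⟩
    · by_contra hc; exact hB ⟨hi, hc⟩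
  · intro i hi hAB
    simp only [e]
    refine (h.mixed _ hi ?_).symm
    simp only [Set.mem_ofPred_eq, Set.mem_sdiff, not_and, not_not] at hAB hi
    tauto

lemma mem_iff (h : LocalRules r x A B R a) (i : ℤ) :
    i ∈ R ↔ i ∈ A ∨ i ∈ B ∨
      (x i = 0 ∧ wit x R (i - r) = 1 ∧ a i (hgtAt r (wit x R) i) ≠ 0) := by
  constructor
  · intro hi
    by_cases hA : i ∈ A
    · exact Or.inl hA
    by_cases hB : i ∈ B
    · exact Or.inr (Or.inl hB)
    refine Or.inr (Or.inr ⟨h.head i hi, h.tail i hi, ?_⟩)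
    rw [h.loss i hi hA hB]
    simp
  · rintro (hi | hi | ⟨h1, h2, h3⟩)
    · exact h.subset_left hi
    · exact h.subset_right hi
    · by_contra hR
      refine h3 (h.vanish i ?_)
      rw [h2, wit, h1, ind_of_notMem hR]
      simp

/-- The value at the next position is determined by the current state. -/
lemma next_eq (h : LocalRules r x A B R a) (i : ℤ) :
    a (i + 1) = fun n =>
      if n = hgtAt r (wit x R) i then
        if i ∈ A ∧ i ∈ B then a i n + 1 else if i ∈ R ∧ i ∉ A ∧ i ∉ B then a i n - 1 else a i n
      else a i n := by
  funext n
  by_cases hR : i ∈ R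
  · by_cases hA : i ∈ A <;> by_cases hB : i ∈ B
    · rw [h.gain i hA hB]; simp only [hA, hB]; split_ifs <;> simp_all
    · rw [h.mixed i hR (by tauto)]; simp [hA, hB]
    · rw [h.mixed i hR (by tauto)]; simp [hA, hB]
    · rw [h.loss i hR hA hB]; simp only [hA, hB]; split_ifs <;> simp_all
  · have hA : i ∉ A := fun hA => hR (h.subset_left hA)
    rw [h.still i hR]; simp [hA, hR]

lemma unique (hr : 1 ≤ r) (h : LocalRules r x A B R a) (h' : LocalRules r x A B R' a') {N : ℤ}
    (ha : ∀ i ≤ N, a i = a' i) : R = R' ∧ a = a' := by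
  obtain ⟨L, hLN, hL⟩ : ∃ L ≤ N, ∀ j < L, j ∉ R ∧ j ∉ R' := by
    obtain ⟨L, hL⟩ := (h.finite.union h'.finite).bddBelow
    refine ⟨min L N, min_le_right _ _, fun j hj => ⟨fun hR => ?_, fun hR => ?_⟩⟩
    · have := hL (Or.inl hR)
      omega
    · have := hL (Or.inr hR)
      omega
  have step : ∀ i, (∀ j < i, j ∈ R ↔ j ∈ R') → a i = a' i →
      (i ∈ R ↔ i ∈ R') ∧ a (i + 1) = a' (i + 1) := by
    intro i hi hai
    have hw : ∀ j < i, wit x R j = wit x R' j := by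
      intro j hj
      simp only [wit, ind, hi j hj]
    have hg : hgtAt r (wit x R) i = hgtAt r (wit x R') i := hgtAt_congr hw
    have hm : i ∈ R ↔ i ∈ R' := by
      rw [h.mem_iff, h'.mem_iff, hg, hai, hw (i - r) (by omega)]
    exact ⟨hm, by rw [h.next_eq, h'.next_eq, hg, hai]; simp only [hm]⟩
  have main : ∀ i, L ≤ i → (∀ j < i, j ∈ R ↔ j ∈ R') ∧ a i = a' i := by
    intro i hi
    induction i, hi using Int.leInduction with
    | base => exact ⟨fun j hj => iff_of_false (hL j hj).1 (hL j hj).2, ha L hLN⟩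
    | succ i hi ih =>
      have := step i ih.1 ih.2
      refine ⟨fun j hj => ?_, this.2⟩
      rcases (Int.lt_add_one_iff.1 hj).lt_or_eq with hj | rfl
      · exact ih.1 j hj
      · exact this.1
  constructor
  · ext i
    exact (main (max L (i + 1)) (le_max_left _ _)).1 i (by omega)
  · funext i
    rcases le_total L i with hi | hi
    · exact (main i hi).2
    · exact ha i (hi.trans hLN)

lemma eq_of_forall_notMem (h : LocalRules r x A B R a) {i i' : ℤ} (hi : i ≤ i')
    (hR : ∀ j, i ≤ j → j < i' → j ∉ R) : a i' = a i := by
  induction i', hi using Int.leInduction with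
  | base => rfl
  | succ i' hi ih =>
    rw [← h.still i' (hR i' hi (by omega))]
    exact ih fun j hj hj' => hR j hj (by omega)

end LocalRules

lemma exists_history {α : Type*} (P : ℤ → Set ℤ → α → Prop) (F : ℤ → Set ℤ → α → α)
    (N : ℤ) (a₀ : α) : ∃ (R : Set ℤ) (a : ℤ → α), (∀ i < N, i ∉ R) ∧ (∀ i ≤ N, a i = a₀) ∧
      ∀ i, N ≤ i → (i ∈ R ↔ P i (R ∩ Set.Iio i) (a i)) ∧
        a (i + 1) = F i (R ∩ Set.Iio i) (a i) := by
  let S : ℕ → Set ℤ × α := fun n => Nat.rec (∅, a₀)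
    (fun n p => ({j | j ∈ p.1 ∨ (j = N + n ∧ P (N + n) p.1 p.2)}, F (N + n) p.1 p.2)) n
  have hS : ∀ n, S (n + 1) = ({j | j ∈ (S n).1 ∨ (j = N + n ∧ P (N + n) (S n).1 (S n).2)},
    F (N + n) (S n).1 (S n).2) := fun n => rfl
  have hlt : ∀ n, ∀ j ∈ (S n).1, N ≤ j ∧ j < N + n := by
    intro n
    induction n with
    | zero => intro j hj; exact absurd hj (Set.notMem_empty j)
    | succ n ih =>
      intro j hj
      rw [hS] at hj
      rcases hj with hj | ⟨rfl, -⟩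
      · have := ih j hj
        push_cast; omega
      · push_cast; omega
  have hmono : ∀ n m : ℕ, n ≤ m → ∀ j, j < N + n → (j ∈ (S m).1 ↔ j ∈ (S n).1) := by
    intro n m hnm
    induction m, hnm using Nat.le_induction with
    | base => intro j _; rfl
    | succ m hm ih =>
      intro j hj
      rw [← ih j hj, hS]
      simp only [Set.mem_ofPred_eq, or_iff_left_iff_imp]
      rintro ⟨rfl, -⟩
      omega
  have hR : ∀ n : ℕ, {j | ∃ m, j ∈ (S m).1} ∩ Set.Iio (N + n) = (S n).1 := by
    intro n
    ext j
    constructor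
    · rintro ⟨⟨m, hm⟩, hj⟩
      rcases le_total n m with h | h
      · exact (hmono n m h j hj).1 hm
      · exact (hmono m n h j (hlt m j hm).2).2 hm
    · intro hj
      exact ⟨⟨n, hj⟩, (hlt n j hj).2⟩
  refine ⟨{j | ∃ m, j ∈ (S m).1}, fun i => (S (i - N).toNat).2, ?_, ?_, ?_⟩
  · rintro i hi ⟨m, hm⟩
    have := hlt m i hm
    omega
  · intro i hi
    have : (i - N).toNat = 0 := by omega
    simp only [this]
    rfl
  · intro i hi
    obtain ⟨n, rfl⟩ : ∃ n : ℕ, i = N + n := ⟨(i - N).toNat, by omega⟩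
    have e1 : (N + n - N : ℤ).toNat = n := by omega
    have e2 : (N + n + 1 - N : ℤ).toNat = n + 1 := by omega
    simp only [e1, e2, hR, hS, and_true]
    have h1 : N + (n : ℤ) ∈ {j | ∃ m, j ∈ (S m).1} ↔ N + (n : ℤ) ∈ (S (n + 1)).1 := by
      rw [← hR (n + 1)]
      simp
    rw [h1, hS]
    simp only [Set.mem_ofPred_eq, true_and, or_iff_right_iff_imp]
    intro hj
    have := hlt n _ hj
    omega

set_option maxHeartbeats 1000000 in
/-- Running the local rules from the left, starting in a region where `x` is constant. -/
lemma exists_localRules {r : ℕ} (hr : 1 ≤ r) {x m n : ℤ → ℕ} {A B : Set ℤ} {N : ℤ} {c : ℕ}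
    {a₀ : ℕ → ℕ} (hA : RibbonSet r x m A) (hB : RibbonSet r x n B) (hx : ∀ i, x i ≤ 1)
    (hAN : ∀ i ∈ A, N ≤ i) (hBN : ∀ i ∈ B, N ≤ i) (hxN : ∀ i < N, x i = c)
    (ha₀ : ∀ h, c * r ≤ h → a₀ h = 0) :
    ∃ (R : Set ℤ) (a : ℤ → ℕ → ℕ), LocalRules r x A B R a ∧ (∀ i < N, i ∉ R) ∧
      (∀ i ≤ N, a i = a₀) ∧ (∀ i, wit x R i ≤ 1) ∧
      ∀ i, N ≤ i → ∀ h, hgtAt (r + 1) (wit x R) i ≤ h → a i h = 0 := by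
  obtain ⟨R, a, hRN, haN, hstep⟩ := exists_history
    (fun i R (v : ℕ → ℕ) => i ∈ A ∨ i ∈ B ∨
      (x i = 0 ∧ wit x R (i - r) = 1 ∧ v (hgtAt r (wit x R) i) ≠ 0))
    (fun i R v h => if h = hgtAt r (wit x R) i then
      (if i ∈ A ∧ i ∈ B then v h + 1 else
        if x i = 0 ∧ wit x R (i - r) = 1 ∧ i ∉ A ∧ i ∉ B then v h - 1 else v h) else v h)
    N a₀
  have hcut : ∀ i, ∀ j < i, wit x (R ∩ Set.Iio i) j = wit x R j := by
    intro i j hj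
    simp [wit, ind, hj]
  have hcutg : ∀ i, hgtAt r (wit x (R ∩ Set.Iio i)) i = hgtAt r (wit x R) i :=
    fun i => hgtAt_congr (hcut i)
  have hmem : ∀ i, N ≤ i → (i ∈ R ↔ i ∈ A ∨ i ∈ B ∨
      (x i = 0 ∧ wit x R (i - r) = 1 ∧ a i (hgtAt r (wit x R) i) ≠ 0)) := by
    intro i hi
    rw [(hstep i hi).1, hcutg, hcut i (i - r) (by omega)]
  have hnext : ∀ i, N ≤ i → ∀ h, a (i + 1) h = if h = hgtAt r (wit x R) i then
      (if i ∈ A ∧ i ∈ B then a i h + 1 else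
        if x i = 0 ∧ wit x R (i - r) = 1 ∧ i ∉ A ∧ i ∉ B then a i h - 1 else a i h)
      else a i h := by
    intro i hi h
    rw [(hstep i hi).2]
    simp only
    rw [hcutg, hcut i (i - r) (by omega)]
  have hge : ∀ i ∈ R, N ≤ i := fun i hi => not_lt.1 fun h => hRN i h hi
  have hAR : A ⊆ R := fun i hi => (hmem i (hAN i hi)).2 (Or.inl hi)
  have hBR : B ⊆ R := fun i hi => (hmem i (hBN i hi)).2 (Or.inr (Or.inl hi))
  have hhead : ∀ i ∈ R, x i = 0 := by
    intro i hi
    rcases (hmem i (hge i hi)).1 hi with h | h | h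
    · exact hA.head i h
    · exact hB.head i h
    · exact h.1
  have hbit : ∀ i, wit x R i ≤ 1 := by
    intro i
    unfold wit
    by_cases hi : i ∈ R
    · rw [hhead i hi, ind_of_mem hi]
    · rw [ind_of_notMem hi]; exact hx i
  have hle : ∀ {C : Set ℤ}, C ⊆ R → ∀ i, wit x C i ≤ wit x R i := by
    intro C hC i
    unfold wit
    by_cases hi : i ∈ C
    · rw [ind_of_mem hi, ind_of_mem (hC hi)]
    · rw [ind_of_notMem hi]; omega
  have htail : ∀ i ∈ R, wit x R (i - r) = 1 := by
    intro i hi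
    refine le_antisymm (hbit _) ?_
    rcases (hmem i (hge i hi)).1 hi with h | h | h
    · refine le_trans ?_ (hle hAR _)
      rw [hA.wit_sub, ind_of_mem h]; omega
    · refine le_trans ?_ (hle hBR _)
      rw [hB.wit_sub, ind_of_mem h]; omega
    · exact h.2.1.ge
  have hgain : ∀ i, i ∈ A → i ∈ B →
      a (i + 1) = fun h => a i h + (if h = hgtAt r (wit x R) i then 1 else 0) := by
    intro i h1 h2
    funext h
    rw [hnext i (hAN i h1)]
    simp only [h1, h2, and_self, if_true]
    split_ifs <;> rfl
  have hloss : ∀ i, i ∈ R → i ∉ A → i ∉ B →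
      a i = fun h => a (i + 1) h + (if h = hgtAt r (wit x R) i then 1 else 0) := by
    intro i hi h1 h2
    have h3 := ((hmem i (hge i hi)).1 hi).resolve_left h1 |>.resolve_left h2
    funext h
    rw [hnext i (hge i hi)]
    by_cases h4 : h = hgtAt r (wit x R) i
    · subst h4
      have := h3.2.2
      simp only [h1, h2, h3.1, h3.2.1, and_self, not_false_eq_true, if_true, if_false]
      omega
    · simp only [h4, if_false, add_zero]
  have hmixed : ∀ i, i ∈ R → (i ∈ A ↔ i ∉ B) → a i = a (i + 1) := by
    intro i hi hAB
    funext h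
    rw [hnext i (hge i hi)]
    by_cases h1 : i ∈ A
    · simp [h1, hAB.1 h1]
    · have : i ∈ B := by tauto
      simp [h1, this]
  have hstill : ∀ i, i ∉ R → a i = a (i + 1) := by
    intro i hi
    rcases lt_or_ge i N with h | h
    · rw [haN i h.le, haN (i + 1) (by omega)]
    · funext t
      have h1 : i ∉ A := fun h => hi (hAR h)
      have h2 := mt (hmem i h).2 hi
      rw [hnext i h]
      simp only [h1, false_and, if_false]
      split_ifs with h3 h4
      · subst h3
        have : a i (hgtAt r (wit x R) i) = 0 := by tauto
        omega
      · rfl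
      · rfl
  have hoff : ∀ i h, h ≠ hgtAt r (wit x R) i → a (i + 1) h = a i h := by
    intro i h hh
    rcases lt_or_ge i N with hi | hi
    · rw [haN i hi.le, haN (i + 1) (by omega)]
    · rw [hnext i hi, if_neg hh]
  have hsupp : ∀ i, N ≤ i → ∀ h, hgtAt (r + 1) (wit x R) i ≤ h → a i h = 0 := by
    intro i hi
    induction i, hi using Int.leInduction with
    | base =>
      intro h hh
      rw [haN N le_rfl]
      refine ha₀ h (le_trans (le_of_eq ?_) hh)
      unfold hgtAt
      rw [Finset.sum_congr rfl (g := fun _ => c), Finset.sum_const, Nat.card_Ico, smul_eq_mul,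
        Nat.add_sub_cancel, mul_comm]
      intro j hj
      rw [Finset.mem_Ico] at hj
      rw [wit, hxN _ (by omega), ind_of_notMem (hRN _ (by omega)), add_zero]
    | succ i hi ih =>
      intro h hh
      rw [hgtAt_succ_succ _ _ hr] at hh
      rw [hgtAt_succ_eq hr] at ih
      have b1 := hbit i
      have b2 := hbit (i - r)
      by_cases hiR : i ∈ R
      · have e1 : wit x R i = 1 := by rw [wit, hhead i hiR, ind_of_mem hiR]
        have e2 := htail i hiR
        rw [hoff i h (by omega)]
        exact ih h (by omega)
      · rw [← hstill i hiR]
        by_cases hh' : hgtAt r (wit x R) i + wit x R (i - r) ≤ h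
        · exact ih h hh'
        · have e1 : wit x R (i - r) = 1 := by omega
          have e2 : h = hgtAt r (wit x R) i := by omega
          have e3 : wit x R i = 0 := by omega
          have e4 : x i = 0 := by unfold wit at e3; omega
          have := mt (hmem i hi).2 hiR
          subst e2
          tauto
  have hvanish : ∀ i, wit x R (i - r) ≠ wit x R i → a i (hgtAt r (wit x R) i) = 0 := by
    intro i hi
    have b1 := hbit i
    have b2 := hbit (i - r)
    rcases lt_or_ge i N with h | h
    · refine absurd ?_ hi
      rw [wit, wit, hxN _ h, hxN (i - r) (by omega), ind_of_notMem (hRN _ h),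
        ind_of_notMem (hRN (i - r) (by omega))]
    · by_cases h0 : wit x R (i - r) = 0
      · refine hsupp i h _ ?_
        rw [hgtAt_succ_eq hr]
        omega
      · have e1 : wit x R (i - r) = 1 := by omega
        have e3 : wit x R i = 0 := by omega
        have e4 : x i = 0 := by unfold wit at e3; omega
        have e5 : i ∉ R := by
          intro hR
          rw [wit, ind_of_mem hR] at e3
          omega
        have := mt (hmem i h).2 e5
        tauto
  have hfin : R.Finite := by
    obtain ⟨M, hM⟩ := (hA.finite.union hB.finite).bddAbove
    set M' := max N (M + 1) with hM'
    have hout : ∀ i, M' ≤ i → i ∉ A ∧ i ∉ B := fun i hi =>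
      ⟨fun h => by have := hM (Or.inl h); omega, fun h => by have := hM (Or.inr h); omega⟩
    let Φ : ℕ → ℕ := fun t => ∑ h ∈ Finset.range r, a (M' + t) h
    have hΦ : ∀ t : ℕ, (M' + t ∈ R → Φ (t + 1) + 1 = Φ t) ∧ (M' + t ∉ R → Φ (t + 1) = Φ t) := by
      intro t
      have e : M' + ((t + 1 : ℕ) : ℤ) = M' + t + 1 := by push_cast; ring
      constructor
      · intro ht
        have ho := hout (M' + t) (by omega)
        simp only [Φ, e]
        rw [hloss _ ht ho.1 ho.2, Finset.sum_add_distrib, Finset.sum_ite_eq' _ _ (fun _ => 1),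
          if_pos]
        have := hgtAt_le hbit (M' + t) (r := r)
        rw [Finset.mem_range]
        omega
      · intro ht
        simp only [Φ, e]
        rw [hstill _ ht]
    have hanti : Antitone Φ := antitone_nat_of_succ_le fun t => by
      by_cases ht : M' + t ∈ R
      · have := (hΦ t).1 ht; omega
      · exact ((hΦ t).2 ht).le
    obtain ⟨t₀, ht₀⟩ : ∃ t₀, ∀ t, Φ t₀ ≤ Φ t :=
      ⟨Function.argmin Φ, fun t => Function.argmin_le Φ t⟩
    refine (Set.finite_Ico N (M' + t₀)).subset fun i hi => ⟨hge i hi, ?_⟩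
    by_contra hlt
    obtain ⟨t, rfl⟩ : ∃ t : ℕ, i = M' + t := ⟨(i - M').toNat, by omega⟩
    have h1 := (hΦ t).1 hi
    have h2 := hanti (show t₀ ≤ t by omega)
    have h3 := ht₀ (t + 1)
    omega
  exact ⟨R, a, ⟨hfin, hAR, hBR, hhead, htail, hstill, hvanish, hgain, hloss, hmixed⟩,
    hRN, haN, hbit, hsupp⟩

lemma IsBSC.exists_localRules {r : ℕ} (hr : 1 ≤ r) {l m n k : ℤ → ℕ} {aL aG : ℕ → ℕ}
    (h : IsBSC r l m n k aL aG) :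
    ∃ (A B R : Set ℤ) (a : ℤ → ℕ → ℕ), RibbonSet r l m A ∧ RibbonSet r l n B ∧
      RibbonSet r l k R ∧ RibbonSet r m k (R \ A) ∧ RibbonSet r n k (R \ B) ∧
      LocalRules r l A B R a ∧ (∀ i, (∀ j < i, j ∉ R) → a i = aL) ∧
      (∀ i, (∀ j, i ≤ j → j ∉ R) → a i = aG) := by
  obtain ⟨h1, h2, h3, h4, h5, h6⟩ := h
  obtain ⟨A, hA⟩ := h1.exists_ribbonSet
  obtain ⟨B, hB⟩ := h2.exists_ribbonSet
  obtain ⟨C, hC⟩ := h3.exists_ribbonSet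
  obtain ⟨D, hD⟩ := h4.exists_ribbonSet
  obtain ⟨R, hR⟩ := h5.exists_ribbonSet
  obtain ⟨hAR, rfl⟩ := RibbonSet.subset_and_eq_diff hr hA hC hR
  obtain ⟨hBR, rfl⟩ := RibbonSet.subset_and_eq_diff hr hB hD hR
  obtain ⟨a, ha⟩ := h6 _ hR.isWitness
  simp only [hR.quad_iff, hA.ribbonAt_iff hr, hB.ribbonAt_iff hr, hC.ribbonAt_iff hr,
    hD.ribbonAt_iff hr, Set.mem_sdiff] at ha
  refine ⟨A, B, R, a, hA, hB, hR, hC, hD, ⟨hR.finite, hAR, hBR, hR.head, ?_, fun i => (ha i).1,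
    fun i => (ha i).2.1, fun i h1 h2 => (ha i).2.2.1 (hAR h1) h1 h2,
    fun i h1 h2 h3 => (ha i).2.2.2.1 h1 ⟨h1, h2⟩ ⟨h1, h3⟩,
    fun i h1 h2 => (ha i).2.2.2.2.1 h1 (by tauto) (by tauto)⟩,
    fun i => (ha i).2.2.2.2.2.1, fun i => (ha i).2.2.2.2.2.2⟩
  intro i hi
  rw [hR.wit_sub, hR.tail i hi, ind_of_mem hi]

lemma LocalRules.isBSC {r : ℕ} (hr : 1 ≤ r) {l m n k : ℤ → ℕ} {aL aG : ℕ → ℕ}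
    {A B R : Set ℤ} {a : ℤ → ℕ → ℕ} (h : LocalRules r l A B R a)
    (hA : RibbonSet r l m A) (hB : RibbonSet r l n B) (hR : RibbonSet r l k R)
    (hC : RibbonSet r m k (R \ A)) (hD : RibbonSet r n k (R \ B))
    (hL : ∀ i, (∀ j < i, j ∉ R) → a i = aL) (hG : ∀ i, (∀ j, i ≤ j → j ∉ R) → a i = aG) :
    IsBSC r l m n k aL aG := by
  refine ⟨hA.hStrip, hB.hStrip, hC.hStrip, hD.hStrip, hR.hStrip, fun w hw => ⟨a, fun i => ?_⟩⟩
  obtain ⟨h1, h2⟩ := hw.ribbonSet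
  rw [RibbonSet.unique hr h1 hR] at h2
  subst h2
  simp only [hR.quad_iff, hA.ribbonAt_iff hr, hB.ribbonAt_iff hr, hC.ribbonAt_iff hr,
    hD.ribbonAt_iff hr, Set.mem_sdiff]
  exact ⟨h.still i, h.vanish i, fun _ => h.gain i, fun h1 h2 h3 => h.loss i h1 h2.2 h3.2,
    fun h1 h2 h3 => h.mixed i h1 (by tauto), hL i, hG i⟩

/-- The total value change of an integer function that only changes at positions in `S`. -/
lemma sub_eq_sum_of_step {F d : ℤ → ℤ} {S : Finset ℤ} {p q : ℤ}
    (hF : ∀ i, F (i + 1) - F i = if i ∈ S then d i else 0)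
    (hp : ∀ i, (∀ j < i, j ∉ S) → F i = p) (hq : ∀ i, (∀ j, i ≤ j → j ∉ S) → F i = q) :
    q - p = ∑ i ∈ S, d i := by
  obtain ⟨L, hL⟩ := S.bddBelow
  obtain ⟨U, hU⟩ := S.bddAbove
  have key : ∀ i, L ≤ i → F i - F L = ∑ j ∈ S with j < i, d j := by
    intro i hi
    induction i, hi using Int.leInduction with
    | base =>
      rw [sub_self, Finset.filter_false_of_mem fun j hj => not_lt.2 (hL hj), Finset.sum_empty]
    | succ i hi ih =>
      have e : F (i + 1) - F L = (F i - F L) + (F (i + 1) - F i) := by ring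
      rw [e, ih, hF]
      split_ifs with h
      · have : {j ∈ S | j < i + 1} = insert i {j ∈ S | j < i} := by
          ext j
          simp only [Finset.mem_filter, Finset.mem_insert]
          constructor
          · rintro ⟨h1, h2⟩
            rcases (Int.lt_add_one_iff.1 h2).lt_or_eq with h3 | h3
            · exact Or.inr ⟨h1, h3⟩
            · exact Or.inl h3
          · rintro (rfl | ⟨h1, h2⟩)
            · exact ⟨h, by omega⟩
            · exact ⟨h1, by omega⟩
        rw [this, Finset.sum_insert (by simp), add_comm]
      · rw [add_zero]
        refine Finset.sum_congr (Finset.filter_congr fun j hj => ?_) fun _ _ => rfl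
        have : j ≠ i := fun e => h (e ▸ hj)
        omega
  have h1 := key (max L (U + 1)) (le_max_left _ _)
  rw [hp L fun j hj hjS => not_lt.2 (hL hjS) hj,
    hq (max L (U + 1)) fun j hj hjS => by have := hU hjS; omega,
    Finset.filter_true_of_mem fun j hj => by have := hU hj; omega] at h1
  exact h1

lemma LocalRules.sum_weights {r : ℕ} (hr : 1 ≤ r) {l : ℤ → ℕ} {aL : ℕ → ℕ}
    {A B R : Set ℤ} {a : ℤ → ℕ → ℕ} (h : LocalRules r l A B R a) (hl : ∀ i, wit l R i ≤ 1)
    (hL : ∀ i, (∀ j < i, j ∉ R) → a i = aL)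
    (hG : ∀ i, (∀ j, i ≤ j → j ∉ R) → a i = fun _ => 0) (g : ℕ → ℕ) :
    ∑ i ∈ h.finite.toFinset, g (hgtAt r (wit l R) i) =
      (∑ i ∈ h.finite.toFinset with i ∈ A, g (hgtAt r (wit l R) i)) +
      (∑ i ∈ h.finite.toFinset with i ∈ B, g (hgtAt r (wit l R) i)) +
      ∑ t ∈ Finset.range r, g t * aL t := by
  have hsum : ∀ (v : ℕ → ℕ) (i : ℤ), (∑ t ∈ Finset.range r,
      (g t : ℤ) * ((v t + (if t = hgtAt r (wit l R) i then 1 else 0) : ℕ) : ℤ)) =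
      (∑ t ∈ Finset.range r, (g t : ℤ) * (v t : ℤ)) + g (hgtAt r (wit l R) i) := by
    intro v i
    have hlt : hgtAt r (wit l R) i ∈ Finset.range r := by
      have := hgtAt_le hl i (r := r)
      rw [Finset.mem_range]; omega
    simp only [Nat.cast_add, mul_add, Finset.sum_add_distrib, Nat.cast_ite, Nat.cast_one,
      Nat.cast_zero, mul_ite, mul_one, mul_zero, Finset.sum_ite_eq', hlt, if_true]
  have := sub_eq_sum_of_step (F := fun i => ∑ t ∈ Finset.range r, (g t : ℤ) * (a i t : ℤ))
    (d := fun i => (g (hgtAt r (wit l R) i) : ℤ) *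
      ((if i ∈ A then 1 else 0) + (if i ∈ B then 1 else 0) - 1))
    (S := h.finite.toFinset) (p := ∑ t ∈ Finset.range r, (g t : ℤ) * (aL t : ℤ)) (q := 0)
    ?_ ?_ ?_
  · simp only [mul_sub, mul_add, mul_ite, mul_one, mul_zero, Finset.sum_sub_distrib,
      Finset.sum_add_distrib, ← Finset.sum_filter] at this
    zify
    linarith
  · intro i
    simp only [Set.Finite.mem_toFinset]
    split_ifs with hi h1 h2 h2
    · rw [h.gain i h1 h2, hsum]; ring
    · rw [h.mixed i hi (by tauto)]; ring
    · rw [h.mixed i hi (by tauto)]; ring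
    · rw [h.loss i hi h1 h2, hsum]; ring
    · rw [h.still i hi]; ring
  · intro i hi
    simp only [Set.Finite.mem_toFinset] at hi
    simp only [hL i hi]
  · intro i hi
    simp only [Set.Finite.mem_toFinset] at hi
    simp [hG i hi]

lemma sum_ind_sub {A C : Set ℤ} (hA : A.Finite) (hC : C.Finite) (j : ℤ) :
    ∑ i ∈ hA.toFinset, ind C (i - j) = ∑ i ∈ hC.toFinset, ind A (i + j) := by
  simp only [ind, Finset.sum_boole, Nat.cast_id]
  refine Finset.card_nbij' (fun i => i - j) (fun i => i + j) ?_ ?_ ?_ ?_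
  · intro i hi; simpa [and_comm] using hi
  · intro i hi; simpa [and_comm] using hi
  · intro i _; simp
  · intro i _; simp

/-- Splitting a strip into two consecutive strips lowers the heights in both of them by the
same total amount. -/
lemma exists_twoSpin_add {r : ℕ} (hr : 1 ≤ r) {l m k : ℤ → ℕ} {A R : Set ℤ} (hAR : A ⊆ R)
    (hA : RibbonSet r l m A) (hR : RibbonSet r l k R) :
    ∃ X, twoSpin r l m + X = (∑ i ∈ hR.finite.toFinset with i ∈ A, hgtAt r (wit l R) i) ∧
      twoSpin r l m + twoSpin r m k + 2 * X = ∑ i ∈ hR.finite.toFinset, hgtAt r (wit l R) i := by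
  have hC := hA.diff_of_subset hR hAR
  have eA : ({i ∈ hR.finite.toFinset | i ∈ A} : Finset ℤ) = hA.finite.toFinset := by
    ext i
    simp only [Finset.mem_filter, Set.Finite.mem_toFinset]
    exact ⟨fun h => h.2, fun h => ⟨hAR h, h⟩⟩
  have eC : ({i ∈ hR.finite.toFinset | i ∉ A} : Finset ℤ) = hC.finite.toFinset := by
    ext i
    simp only [Finset.mem_filter, Set.Finite.mem_toFinset, Set.mem_sdiff]
  have h1 : ∀ i, hgtAt r (wit l A) i + ∑ j ∈ Finset.Ico 1 r, ind (R \ A) (i - j) =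
      hgtAt r (wit l R) i := by
    intro i
    unfold hgtAt
    rw [← Finset.sum_add_distrib]
    refine Finset.sum_congr rfl fun j _ => ?_
    have := ind_diff_add hAR (i - j)
    unfold wit
    omega
  have h2 : ∀ i, hgtAt r (wit m (R \ A)) i + ∑ j ∈ Finset.Ico 1 r, ind A (i + j) =
      hgtAt r (wit l R) i := by
    intro i
    have e : ∑ j ∈ Finset.Ico 1 r, ind A (i + j) = ∑ j ∈ Finset.Ico 1 r, ind A (i - j + r) := by
      refine Finset.sum_nbij' (fun j => r - j) (fun j => r - j) ?_ ?_ ?_ ?_ ?_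
      · intro j hj; rw [Finset.mem_Ico] at hj ⊢; omega
      · intro j hj; rw [Finset.mem_Ico] at hj ⊢; omega
      · intro j hj; rw [Finset.mem_Ico] at hj; omega
      · intro j hj; rw [Finset.mem_Ico] at hj; omega
      · intro j hj
        rw [Finset.mem_Ico] at hj
        rw [Nat.cast_sub hj.2.le]
        exact congrArg _ (by ring)
    rw [e]
    unfold hgtAt
    rw [← Finset.sum_add_distrib]
    refine Finset.sum_congr rfl fun j _ => ?_
    have := ind_diff_add hAR (i - j)
    have := hA.balance (i - j)
    unfold wit
    omega
  have h3 : ∑ i ∈ hA.finite.toFinset, ∑ j ∈ Finset.Ico 1 r, ind (R \ A) (i - j) =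
      ∑ i ∈ hC.finite.toFinset, ∑ j ∈ Finset.Ico 1 r, ind A (i + j) := by
    rw [Finset.sum_comm, Finset.sum_comm (s := hC.finite.toFinset)]
    exact Finset.sum_congr rfl fun j _ => sum_ind_sub hA.finite hC.finite j
  refine ⟨∑ i ∈ hA.finite.toFinset, ∑ j ∈ Finset.Ico 1 r, ind (R \ A) (i - j), ?_⟩
  have t1 := hA.twoSpin_eq hr
  have t2 := hC.twoSpin_eq hr
  have s1 : (∑ i ∈ hR.finite.toFinset with i ∈ A, hgtAt r (wit l R) i) = _ :=
    Finset.sum_congr eA fun i _ => (h1 i).symm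
  have s2 : (∑ i ∈ hR.finite.toFinset with i ∉ A, hgtAt r (wit l R) i) = _ :=
    Finset.sum_congr eC fun i _ => (h2 i).symm
  have s3 := Finset.sum_filter_add_sum_filter_not hR.finite.toFinset (· ∈ A)
    (hgtAt r (wit l R))
  rw [Finset.sum_add_distrib] at s1 s2
  omega

lemma IsBSC.count_and_spin {r : ℕ} (hr : 1 ≤ r) {l m n k : ℤ → ℕ} (hl : ∀ i, l i ≤ 1)
    {aL : ℕ → ℕ} (h : IsBSC r l m n k aL (fun _ => 0)) :
    ribCount r m k = ribCount r l n + (∑ i ∈ Finset.range r, aL i) ∧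
    twoSpin r m k + twoSpin r n k = twoSpin r l m + twoSpin r l n +
      2 * ∑ i ∈ Finset.range r, i * aL i := by
  obtain ⟨A, B, R, a, hA, hB, hR, hC, hD, hrules, hL, hG⟩ := h.exists_localRules hr
  have hw : ∀ i, wit l R i ≤ 1 := by
    intro i
    unfold wit
    by_cases hi : i ∈ R
    · rw [hR.head i hi, ind_of_mem hi]
    · rw [ind_of_notMem hi]; exact hl i
  have hAR := hrules.subset_left
  have hBR := hrules.subset_right
  constructor
  · have := hrules.sum_weights hr hw hL hG (fun _ => 1)
    simp only [Finset.sum_const, smul_eq_mul, mul_one, one_mul] at this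
    rw [hC.ribCount_eq hr, hB.ribCount_eq hr]
    have e : ∀ {S : Set ℤ}, S ⊆ R →
        ({i ∈ hrules.finite.toFinset | i ∈ S} : Finset ℤ).card = S.ncard := by
      intro S hS
      rw [← Set.ncard_coe_finset]
      congr 1
      ext i
      simp only [Finset.coe_filter, Set.Finite.mem_toFinset, Set.mem_ofPred_eq]
      exact ⟨fun h => h.2, fun h => ⟨hS h, h⟩⟩
    rw [e hAR, e hBR, ← Set.ncard_eq_toFinset_card R hrules.finite] at this
    have := Set.ncard_sdiff_add_ncard_of_subset hAR hrules.finite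
    omega
  · have := hrules.sum_weights hr hw hL hG id
    simp only [id] at this
    obtain ⟨X, hX1, hX2⟩ := exists_twoSpin_add hr hAR hA hR
    obtain ⟨Y, hY1, hY2⟩ := exists_twoSpin_add hr hBR hB hR
    omega

/-- The bit sequences that are eventually `1` to the left, eventually `0` to the right, and
balanced around the origin. -/
structure IsEdge (s : ℤ → ℕ) : Prop where
  bit : ∀ i, s i ≤ 1
  charge : ∃ N₀ : ℕ, ∀ N : ℕ, N₀ ≤ N → (∀ i < -(N : ℤ), s i = 1) ∧ (∀ i, (N : ℤ) ≤ i → s i = 0) ∧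
    ∑ i ∈ Finset.Ico (-(N : ℤ)) N, s i = N

lemma IsPartition.isEdge {f : ℕ → ℕ} (hf : IsPartition f) : IsEdge (edgeSeq f) := by
  obtain ⟨hmono, M, hM⟩ := hf
  refine ⟨fun i => by unfold edgeSeq; split_ifs <;> simp, max M (f 0), fun N hN => ⟨?_, ?_, ?_⟩⟩
  · intro i hi
    refine if_pos ⟨(-i - 1).toNat, ?_⟩
    rw [hM _ (by omega)]
    omega
  · intro i hi
    refine if_neg ?_
    rintro ⟨j, hj⟩
    have := hmono 0 j (Nat.zero_le j)
    omega
  · unfold edgeSeq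
    rw [Finset.sum_boole, Nat.cast_id]
    have : ({i ∈ Finset.Ico (-(N : ℤ)) N | ∃ j : ℕ, (f j : ℤ) - (j : ℤ) - 1 = i} : Finset ℤ) =
        (Finset.range N).image fun j : ℕ => (f j : ℤ) - (j : ℤ) - 1 := by
      ext i
      simp only [Finset.mem_filter, Finset.mem_Ico, Finset.mem_image, Finset.mem_range]
      constructor
      · rintro ⟨⟨h1, h2⟩, j, rfl⟩
        refine ⟨j, ?_, rfl⟩
        by_contra hj
        rw [hM j (by omega)] at h1
        omega
      · rintro ⟨j, hj, rfl⟩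
        have := hmono 0 j (Nat.zero_le j)
        exact ⟨⟨by omega, by omega⟩, j, rfl⟩
    rw [this, Finset.card_image_of_injective, Finset.card_range]
    intro a b hab
    simp only at hab
    rcases le_total a b with h | h
    · have := hmono a b h; omega
    · have := hmono b a h; omega

lemma edgeSeq_injOn {f g : ℕ → ℕ} (hf : IsPartition f) (hg : IsPartition g)
    (h : edgeSeq f = edgeSeq g) : f = g := by
  have hs : ∀ {f : ℕ → ℕ}, IsPartition f → StrictMono fun j : ℕ => (j : ℤ) + 1 - f j := by
    intro f hf
    refine strictMono_nat_of_lt_succ fun j => ?_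
    have := hf.1 j (j + 1) (Nat.le_succ j)
    push_cast
    omega
  have hr : ∀ (f : ℕ → ℕ) (i : ℤ),
      i ∈ Set.range (fun j : ℕ => (j : ℤ) + 1 - f j) ↔ edgeSeq f (-i) = 1 := by
    intro f i
    unfold edgeSeq
    constructor
    · rintro ⟨j, hj⟩
      refine if_pos ⟨j, ?_⟩
      simp only at hj
      omega
    · intro hi
      split_ifs at hi with hj
      obtain ⟨j, hj⟩ := hj
      refine ⟨j, ?_⟩
      simp only
      omega
  have := (StrictMono.range_inj (hs hf) (hs hg)).1 (by ext i; rw [hr, hr, h])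
  funext j
  have := congrFun this j
  omega

lemma IsEdge.exists_partition {s : ℤ → ℕ} (hs : IsEdge s) :
    ∃ f, IsPartition f ∧ edgeSeq f = s := by
  obtain ⟨hbit, N, hN⟩ := hs
  obtain ⟨hleft, hright, hsum⟩ := hN N le_rfl
  let p : ℕ → Prop := fun n => s (N - 1 - n) = 1
  have hp : ∀ n, 2 * N ≤ n → p n := fun n hn => hleft _ (by omega)
  have hinf : {n | p n}.Infinite :=
    (Set.Ici_infinite (2 * N)).mono fun n hn => hp n hn
  have hcount0 : Nat.count p (2 * N) = N := by
    rw [Nat.count_eq_card_filter_range, Finset.card_filter]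
    refine Eq.trans ?_ hsum
    refine Finset.sum_nbij' (fun n : ℕ => (N : ℤ) - 1 - n) (fun i => (N - 1 - i).toNat)
      ?_ ?_ ?_ ?_ ?_
    · intro n hn; rw [Finset.mem_range] at hn; rw [Finset.mem_Ico]; omega
    · intro i hi; rw [Finset.mem_Ico] at hi; rw [Finset.mem_range]; omega
    · intro n _; omega
    · intro i hi; rw [Finset.mem_Ico] at hi; omega
    · intro n _
      have := hbit (N - 1 - n)
      simp only [p]
      split_ifs with h
      · exact h.symm
      · omega
  have hcount : ∀ j, Nat.count p (2 * N + j) = N + j := by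
    intro j
    induction j with
    | zero => exact hcount0
    | succ j ih => rw [← add_assoc, Nat.count_succ, ih, if_pos (hp _ (by omega)), add_assoc]
  have hcount_le : ∀ j, j ≤ Nat.count p (N + j) := by
    intro j
    rcases le_total N j with h | h
    · obtain ⟨t, rfl⟩ := Nat.exists_eq_add_of_le h
      rw [show N + (N + t) = 2 * N + t by ring, hcount]
    · have h1 := Nat.count_add p (N + j) (N - j)
      have h2 := Nat.count_le (p := fun k => p (N + j + k)) (n := N - j)
      rw [show N + j + (N - j) = 2 * N by omega, hcount0] at h1
      omega
  have hnth_le : ∀ j, Nat.nth p j ≤ N + j := by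
    intro j
    have h1 := hcount_le (j + 1)
    have h2 := Nat.nth_lt_of_lt_count (p := p) (n := N + (j + 1)) (k := j) (by omega)
    omega
  have hstrict : ∀ j, Nat.nth p j + 1 ≤ Nat.nth p (j + 1) :=
    fun j => Nat.nth_strictMono hinf (Nat.lt_succ_self j)
  refine ⟨fun j => N + j - Nat.nth p j, ⟨?_, N, ?_⟩, ?_⟩
  · intro i j hij
    refine antitone_nat_of_succ_le (f := fun j => N + j - Nat.nth p j) (fun j => ?_) hij
    have := hstrict j
    omega
  · intro n hn
    obtain ⟨t, rfl⟩ := Nat.exists_eq_add_of_le hn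
    have h1 := Nat.nth_count (hp (2 * N + t) (by omega))
    rw [hcount] at h1
    simp only
    omega
  · funext i
    unfold edgeSeq
    have hiff : (∃ j : ℕ, ((N + j - Nat.nth p j : ℕ) : ℤ) - (j : ℤ) - 1 = i) ↔ s i = 1 := by
      constructor
      · rintro ⟨j, hj⟩
        have h1 := hnth_le j
        have h2 : p (Nat.nth p j) := Nat.nth_mem_of_infinite hinf j
        have : (N : ℤ) - 1 - Nat.nth p j = i := by omega
        rw [← this]
        exact h2
      · intro hi
        have hiN : i < N := by
          by_contra hc
          have := hright i (by omega)
          omega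
        have h0 : (N : ℤ) - 1 - ((N - 1 - i).toNat : ℕ) = i := by omega
        have h1 : p (N - 1 - i).toNat := by
          simp only [p, h0]
          exact hi
        refine ⟨Nat.count p (N - 1 - i).toNat, ?_⟩
        have h2 := hnth_le (Nat.count p (N - 1 - i).toNat)
        have h3 := Nat.nth_count h1
        omega
    have := hbit i
    simp only [hiff]
    split_ifs with h
    · exact h.symm
    · omega

lemma IsEdge.of_balance {s t : ℤ → ℕ} (hs : IsEdge s) (ht : ∀ i, t i ≤ 1) {R : Set ℤ}
    (hR : R.Finite) {c d : ℤ} (h : ∀ i, t i + ind R (i + c) = s i + ind R (i + d)) :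
    IsEdge t := by
  obtain ⟨N, hN⟩ := hs.charge
  obtain ⟨L, hL⟩ := hR.bddBelow
  obtain ⟨U, hU⟩ := hR.bddAbove
  refine ⟨ht, N + L.natAbs + U.natAbs + c.natAbs + d.natAbs + 1, fun M hM => ?_⟩
  obtain ⟨h1, h2, h3⟩ := hN M (by omega)
  have hmem : ∀ i e : ℤ, (e = c ∨ e = d) → ind R (i + e) ≠ 0 → -(M : ℤ) ≤ i ∧ i < M := by
    intro i e he hi
    have hi' : i + e ∈ R := by
      by_contra hc
      exact hi (ind_of_notMem hc)
    have := hL hi'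
    have := hU hi'
    omega
  have hsum : ∀ e : ℤ, (e = c ∨ e = d) →
      ∑ i ∈ Finset.Ico (-(M : ℤ)) M, ind R (i + e) = hR.toFinset.card := by
    intro e he
    simp only [ind, Finset.sum_boole, Nat.cast_id]
    refine Finset.card_nbij' (fun i => i + e) (fun i => i - e) ?_ ?_ ?_ ?_
    · intro i hi
      simpa using (Finset.mem_filter.1 hi).2
    · intro i hi
      have hi' : i ∈ R := by simpa using hi
      have := hmem (i - e) e he (by rw [sub_add_cancel, ind_of_mem hi']; simp)
      simp [this, hi']
    · intro i _; simp
    · intro i _; simp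
  refine ⟨fun i hi => ?_, fun i hi => ?_, ?_⟩
  · have hc : ind R (i + c) = 0 := by by_contra hc; have := hmem i c (Or.inl rfl) hc; omega
    have hd : ind R (i + d) = 0 := by by_contra hd; have := hmem i d (Or.inr rfl) hd; omega
    have := h i
    rw [h1 i hi] at this
    omega
  · have hc : ind R (i + c) = 0 := by by_contra hc; have := hmem i c (Or.inl rfl) hc; omega
    have hd : ind R (i + d) = 0 := by by_contra hd; have := hmem i d (Or.inr rfl) hd; omega
    have := h i
    rw [h2 i hi] at this
    omega
  · have := Finset.sum_congr (rfl : Finset.Ico (-(M : ℤ)) M = _) fun i _ => h i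
    rw [Finset.sum_add_distrib, Finset.sum_add_distrib, hsum c (Or.inl rfl),
      hsum d (Or.inr rfl), h3] at this
    omega

namespace LocalRules

variable {r : ℕ} {x : ℤ → ℕ} {A B R : Set ℤ} {a : ℤ → ℕ → ℕ}

lemma exists_upper (h : LocalRules r x A B R a) (hw : ∀ i, wit x R i ≤ 1) :
    ∃ y : ℤ → ℕ, (∀ i, y i ≤ 1) ∧ RibbonSet r x y R := by
  have hle : ∀ i, ind R (i + r) ≤ wit x R i := by
    intro i
    by_cases hi : i + r ∈ R
    · have := h.tail _ hi
      rw [add_sub_cancel_right] at this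
      rw [this]
      exact ind_le_one R _
    · rw [ind_of_notMem hi]; exact Nat.zero_le _
  refine ⟨fun i => wit x R i - ind R (i + r), fun i => (Nat.sub_le _ _).trans (hw i),
    h.finite, fun i => Nat.sub_add_cancel (hle i), h.head, fun i hi => ?_⟩
  rw [h.tail i hi, sub_add_cancel, ind_of_mem hi]

lemma eq_of_forall_lt (h : LocalRules r x A B R a) {N : ℤ} {v : ℕ → ℕ}
    (hv : ∀ i ≤ N, a i = v) (i : ℤ) (hi : ∀ j < i, j ∉ R) : a i = v := by
  rcases le_total i N with h' | h'
  · exact hv i h'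
  · rw [h.eq_of_forall_notMem h' fun j _ hj => hi j hj, hv N le_rfl]

/-- The value map is eventually constant to the right. -/
lemma exists_eventually_eq (h : LocalRules r x A B R a) :
    ∃ M, (∀ i, M ≤ i → i ∉ R) ∧ ∀ i, (∀ j, i ≤ j → j ∉ R) → ∀ M', M ≤ M' → a i = a M' := by
  obtain ⟨U, hU⟩ := h.finite.bddAbove
  have hU' : ∀ i, U + 1 ≤ i → i ∉ R := fun i hi hR => by have := hU hR; omega
  refine ⟨U + 1, hU', fun i hi M' hM' => ?_⟩
  rcases le_total i M' with h' | h'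
  · exact (h.eq_of_forall_notMem h' fun j hj _ => hi j hj).symm
  · exact h.eq_of_forall_notMem h' fun j hj _ => hU' j (by omega)

end LocalRules

lemma exists_upper_isBSC {r : ℕ} (hr : 1 ≤ r) {l m n : ℤ → ℕ} (hl : IsEdge l)
    (hm : HStrip r l m) (hn : HStrip r l n) {aL : ℕ → ℕ} (haL : Supported r aL) :
    ∃ k, IsEdge k ∧ IsBSC r l m n k aL (fun _ => 0) := by
  obtain ⟨A, hA⟩ := hm.exists_ribbonSet
  obtain ⟨B, hB⟩ := hn.exists_ribbonSet
  obtain ⟨N, hN⟩ := hl.charge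
  obtain ⟨hN1, hN2, -⟩ := hN N le_rfl
  have hge : ∀ i, l i = 0 → -(N : ℤ) ≤ i := by
    intro i hi
    by_contra hc
    have := hN1 i (by omega)
    omega
  obtain ⟨R, a, h, hRN, haN, hw, hsupp⟩ := exists_localRules hr hA hB hl.bit
    (fun i hi => hge i (hA.head i hi)) (fun i hi => hge i (hB.head i hi)) hN1
    (a₀ := aL) (fun t ht => haL t (by simpa using ht))
  obtain ⟨k, hk, hR⟩ := h.exists_upper hw
  refine ⟨k, hl.of_balance hk h.finite (c := r) (d := 0) (by simpa using hR.balance),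
    h.isBSC hr hA hB hR (hA.diff_of_subset hR h.subset_left) (hB.diff_of_subset hR h.subset_right)
    (h.eq_of_forall_lt haN) ?_⟩
  obtain ⟨M, hM, hM'⟩ := h.exists_eventually_eq
  intro i hi
  set T : ℤ := max M N + r with hT
  rw [hM' i hi T (by omega)]
  funext t
  refine hsupp T (by omega) t (le_trans (le_of_eq ?_) (Nat.zero_le t))
  unfold hgtAt
  refine Finset.sum_eq_zero fun j hj => ?_
  rw [Finset.mem_Ico] at hj
  rw [wit, hN2 _ (by omega), ind_of_notMem (hM _ (by omega)), add_zero]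

lemma exists_lower_isBSC {r : ℕ} (hr : 1 ≤ r) {m n k : ℤ → ℕ} (hk : IsEdge k)
    (hm : HStrip r m k) (hn : HStrip r n k) :
    ∃ (aL : ℕ → ℕ) (l : ℤ → ℕ), Supported r aL ∧ IsEdge l ∧ IsBSC r l m n k aL (fun _ => 0) := by
  obtain ⟨C, hC⟩ := hm.exists_ribbonSet
  obtain ⟨D, hD⟩ := hn.exists_ribbonSet
  obtain ⟨N₀, hN₀⟩ := hk.charge
  obtain ⟨-, hN2, -⟩ := hN₀ N₀ le_rfl
  obtain ⟨L, hL⟩ := (hC.reflect.finite.union hD.reflect.finite).bddBelow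
  set N : ℤ := min L (-N₀) with hN
  obtain ⟨R, a, h, hRN, haN, hw, hsupp⟩ := exists_localRules hr hC.reflect hD.reflect
    (fun i => hk.bit (-i)) (N := N) (c := 0) (a₀ := fun _ => 0)
    (fun i hi => by have := hL (Or.inl hi); omega)
    (fun i hi => by have := hL (Or.inr hi); omega)
    (fun i hi => hN2 (-i) (by omega)) (fun _ _ => rfl)
  obtain ⟨y, hy, hR⟩ := h.exists_upper hw
  have h' := h.reflect hR
  have hR' := hR.reflect
  have hA' := (hC.reflect.diff_of_subset hR h.subset_left).reflect
  have hB' := (hD.reflect.diff_of_subset hR h.subset_right).reflect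
  simp only [neg_neg] at hR' hA' hB'
  obtain ⟨M, hM, hM'⟩ := h.exists_eventually_eq
  refine ⟨a (max M N), fun i => y (-i), fun t ht => ?_,
    hk.of_balance (fun i => hy _) hR'.finite (c := 0) (d := r) fun i => ?_,
    h'.isBSC hr hA' hB' hR' ?_ ?_ ?_ ?_⟩
  · refine hsupp _ (le_max_right _ _) t (le_trans ?_ ht)
    have := hgtAt_le (r := r + 1) hw (max M N)
    omega
  · have := hR'.balance i
    rw [add_zero]
    exact this.symm
  · convert hC using 1
    ext i
    have := @h.subset_left (r - i)
    simp only [Set.mem_sdiff, Set.mem_ofPred_eq, sub_sub_cancel] at this ⊢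
    tauto
  · convert hD using 1
    ext i
    have := @h.subset_right (r - i)
    simp only [Set.mem_sdiff, Set.mem_ofPred_eq, sub_sub_cancel] at this ⊢
    tauto
  · intro i hi
    refine hM' _ (fun j hj hjR => ?_) _ (le_max_left _ _)
    exact hi (r - j) (by omega) (by simpa using hjR)
  · intro i hi
    refine h.eq_of_forall_lt haN _ fun j hj hjR => ?_
    exact hi (r - j) (by omega) (by simpa using hjR)

lemma IsBSC.upper_unique {r : ℕ} (hr : 1 ≤ r) {l m n k k' : ℤ → ℕ} {aL aG aG' : ℕ → ℕ}
    (h : IsBSC r l m n k aL aG) (h' : IsBSC r l m n k' aL aG') : k = k' := by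
  obtain ⟨A, B, R, a, hA, hB, hR, -, -, hrules, hL, -⟩ := h.exists_localRules hr
  obtain ⟨A', B', R', a', hA', hB', hR', -, -, hrules', hL', -⟩ := h'.exists_localRules hr
  obtain rfl := RibbonSet.unique hr hA hA'
  obtain rfl := RibbonSet.unique hr hB hB'
  obtain ⟨N, hN⟩ := (hrules.finite.union hrules'.finite).bddBelow
  have hN' : ∀ j < N, j ∉ R ∧ j ∉ R' := fun j hj =>
    ⟨fun hc => not_lt.2 (hN (Or.inl hc)) hj, fun hc => not_lt.2 (hN (Or.inr hc)) hj⟩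
  obtain ⟨rfl, -⟩ := hrules.unique hr hrules' (N := N) fun i hi => by
    rw [hL i fun j hj => (hN' j (by omega)).1, hL' i fun j hj => (hN' j (by omega)).2]
  funext i
  have := hR.balance i
  have := hR'.balance i
  omega

lemma IsBSC.lower_unique {r : ℕ} (hr : 1 ≤ r) {l l' m n k : ℤ → ℕ} {aL aL' aG : ℕ → ℕ}
    (h : IsBSC r l m n k aL aG) (h' : IsBSC r l' m n k aL' aG) : aL = aL' ∧ l = l' := by
  obtain ⟨A, B, R, a, hA, hB, hR, hC, hD, hrules, hL, hG⟩ := h.exists_localRules hr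
  obtain ⟨A', B', R', a', hA', hB', hR', hC', hD', hrules', hL', hG'⟩ := h'.exists_localRules hr
  have href := hrules.reflect hR
  have href' := hrules'.reflect hR'
  rw [RibbonSet.unique hr hC hC', RibbonSet.unique hr hD hD'] at href
  obtain ⟨M, hM⟩ := (hrules.finite.union hrules'.finite).bddAbove
  have hM' : ∀ j, M < j → j ∉ R ∧ j ∉ R' := fun j hj =>
    ⟨fun hc => not_lt.2 (hM (Or.inl hc)) hj, fun hc => not_lt.2 (hM (Or.inr hc)) hj⟩
  obtain ⟨hRR, haa⟩ := href.unique hr href' (N := r - M) fun i hi => by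
    rw [hG _ fun j hj => (hM' j (by omega)).1, hG' _ fun j hj => (hM' j (by omega)).2]
  have hRR' : R = R' := by
    ext i
    simpa using Set.ext_iff.1 hRR (r - i)
  subst hRR'
  obtain ⟨N, hN⟩ := hrules.finite.bddBelow
  have hN' : ∀ j < N, j ∉ R := fun j hj hc => not_lt.2 (hN hc) hj
  constructor
  · have := congrFun haa (r + 1 - N)
    simp only [show (r : ℤ) - (r + 1 - N) + 1 = N by ring] at this
    rw [← hL N hN', ← hL' N hN', this]
  · funext i
    have := hR.balance i
    have := hR'.balance i
    omega

/-- The spin-preserving shape datum for `(𝒴, ≤ʰᵣ, ℕʳ)`: for partitions `μ, ν`, the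
requirement that `((edge λ, edge μ // edge ν, edge κ), a, 0)` be a basic square
configuration determines a bijection `κ ↦ (a, λ)` between `{κ : μ ≤ʰᵣ κ ≥ʰᵣ ν}` and
`{(a, λ) : a ∈ ℕʳ, μ ≥ʰᵣ λ ≤ʰᵣ ν}`; it satisfies `|κ/μ|ᵣ - |ν/λ|ᵣ = |a|` and the spin
identity `spin(κ/μ) + spin(κ/ν) = spin(μ/λ) + spin(ν/λ) + Σᵢ i·aᵢ` (stated doubled). -/
theorem stmt14 (r : ℕ) (hr : 1 ≤ r) (mu nu : ℕ → ℕ)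
    (hmu : IsPartition mu) (hnu : IsPartition nu) :
    (∀ kap : ℕ → ℕ, IsPartition kap →
      HStrip r (edgeSeq mu) (edgeSeq kap) → HStrip r (edgeSeq nu) (edgeSeq kap) →
      ∃! p : (ℕ → ℕ) × (ℕ → ℕ),
        Supported r p.1 ∧ IsPartition p.2 ∧
        HStrip r (edgeSeq p.2) (edgeSeq mu) ∧ HStrip r (edgeSeq p.2) (edgeSeq nu) ∧
        IsBSC r (edgeSeq p.2) (edgeSeq mu) (edgeSeq nu) (edgeSeq kap) p.1 (fun _ => 0)) ∧
    (∀ (a : ℕ → ℕ) (lam : ℕ → ℕ), Supported r a → IsPartition lam →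
      HStrip r (edgeSeq lam) (edgeSeq mu) → HStrip r (edgeSeq lam) (edgeSeq nu) →
      ∃! kap : ℕ → ℕ, IsPartition kap ∧
        HStrip r (edgeSeq mu) (edgeSeq kap) ∧ HStrip r (edgeSeq nu) (edgeSeq kap) ∧
        IsBSC r (edgeSeq lam) (edgeSeq mu) (edgeSeq nu) (edgeSeq kap) a (fun _ => 0)) ∧
    (∀ (a : ℕ → ℕ) (lam kap : ℕ → ℕ), Supported r a → IsPartition lam → IsPartition kap →
      IsBSC r (edgeSeq lam) (edgeSeq mu) (edgeSeq nu) (edgeSeq kap) a (fun _ => 0) →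
      ribCount r (edgeSeq mu) (edgeSeq kap)
        = ribCount r (edgeSeq lam) (edgeSeq nu) + (∑ i ∈ Finset.range r, a i) ∧
      twoSpin r (edgeSeq mu) (edgeSeq kap) + twoSpin r (edgeSeq nu) (edgeSeq kap)
        = twoSpin r (edgeSeq lam) (edgeSeq mu) + twoSpin r (edgeSeq lam) (edgeSeq nu)
            + 2 * ∑ i ∈ Finset.range r, i * a i) := by
  refine ⟨fun kap hkap h1 h2 => ?_, fun a lam ha hlam h1 h2 => ?_,
    fun a lam kap _ hlam _ h => h.count_and_spin hr hlam.isEdge.bit⟩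
  · obtain ⟨aL, l, ha, hl, hB⟩ := exists_lower_isBSC hr hkap.isEdge h1 h2
    obtain ⟨lam, hlam, rfl⟩ := hl.exists_partition
    refine ⟨(aL, lam), ⟨ha, hlam, hB.1, hB.2.1, hB⟩, ?_⟩
    rintro ⟨a', lam'⟩ ⟨ha', hlam', -, -, hB'⟩
    obtain ⟨rfl, h⟩ := IsBSC.lower_unique hr hB hB'
    rw [edgeSeq_injOn hlam hlam' h]
  · obtain ⟨k, hk, hB⟩ := exists_upper_isBSC hr hlam.isEdge h1 h2 ha
    obtain ⟨kap, hkap, rfl⟩ := hk.exists_partition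
    refine ⟨kap, ⟨hkap, hB.2.2.1, hB.2.2.2.1, hB⟩, ?_⟩
    rintro kap' ⟨hkap', -, -, hB'⟩
    exact edgeSeq_injOn hkap' hkap (IsBSC.upper_unique hr hB' hB)
end

section
/- Fix r ≥ 1 and an r-core γ. Then Σ_{λ} G_λ(q,X)·G_λ(q,Y) = Π_{i,j ∈ ℕ} Π_{k=0}^{r−1} 1/(1 − q^k X_i Y_j), where the sum is over all partitions λ in the r-rim hook lattice of γ, and G_λ(q,X) = Σ_P q^{2·spin(P)} X^{wt(P)} is the spin-weight generating series of semistandard r-ribbon tableaux P of shape λ/γ. -/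
open scoped Classical

/-- A semistandard `r`-ribbon tableau built on `γ`: a chain of horizontal `r`-ribbon
strips starting at `γ` (indexed by `ℕ`; steps with no ribbons leave the shape fixed). -/
def IsSSRT (r : ℕ) (γ : ℕ → ℕ) (c : ℕ → ℕ → ℕ) : Prop :=
  c 0 = γ ∧ (∀ i, IsPartition (c i)) ∧
    ∀ i : ℕ, HStrip r (edgeSeq (c i)) (edgeSeq (c (i + 1)))

/-- Twice the spin of a semistandard `r`-ribbon tableau: the sum of the total heights of
its horizontal `r`-ribbon strips. -/
noncomputable def chainTwoSpin (r : ℕ) (c : ℕ → ℕ → ℕ) : ℕ :=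
  ∑ᶠ i : ℕ, twoSpin r (edgeSeq (c i)) (edgeSeq (c (i + 1)))

/-- The weight of a semistandard `r`-ribbon tableau: the numbers of ribbons in its
successive strips. -/
noncomputable def chainWt (r : ℕ) (c : ℕ → ℕ → ℕ) (i : ℕ) : ℕ :=
  ribCount r (edgeSeq (c i)) (edgeSeq (c (i + 1)))

/-- `|a| = Σ_{h<r} a h` for a vector `a ∈ ℕʳ`. -/
def vnorm (r : ℕ) (v : ℕ → ℕ) : ℕ := ∑ h ∈ Finset.range r, v h

/-- `n(a) = Σ_{h<r} h·a h` for a vector `a ∈ ℕʳ`. -/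
def vcolor (r : ℕ) (v : ℕ → ℕ) : ℕ := ∑ h ∈ Finset.range r, h * v h

namespace RibbonStrip

/-- The `0/1`-valued sequence of a bit sequence. -/
def bit (s : ℤ → Bool) : ℤ → ℕ := fun i => (s i).toNat

/-- Exchange of the bits at distance `r` whose right-hand position is `i`. -/
def hop (r : ℕ) (i : ℤ) (s : ℤ → Bool) : ℤ → Bool := fun p => s (Equiv.swap (i - r) i p)

/-- The number of bits `1` strictly between the positions `i - r` and `i`. -/
noncomputable def between (r : ℕ) (s : ℤ → Bool) (i : ℤ) : ℕ := ∑ p ∈ Finset.Ioo (i - r) i, bit s p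

/-- The number of bits `1` among the `r` positions before `i`. -/
noncomputable def below (r : ℕ) (s : ℤ → Bool) (i : ℤ) : ℕ := ∑ p ∈ Finset.Ico (i - r) i, bit s p

theorem hop_hop (r : ℕ) (i : ℤ) (s : ℤ → Bool) : hop r i (hop r i s) = s := by
  funext p; simp [hop]

theorem hop_right (r : ℕ) (i : ℤ) (s : ℤ → Bool) : hop r i s i = s (i - r) := by simp [hop]

theorem hop_left (r : ℕ) (i : ℤ) (s : ℤ → Bool) : hop r i s (i - r) = s i := by simp [hop]

theorem hop_of_ne {r : ℕ} {i p : ℤ} (s : ℤ → Bool) (h₁ : p ≠ i - r) (h₂ : p ≠ i) :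
    hop r i s p = s p := by simp [hop, Equiv.swap_apply_of_ne_of_ne h₁ h₂]

theorem below_eq {r : ℕ} (hr : 1 ≤ r) (s : ℤ → Bool) (i : ℤ) :
    below r s i = between r s i + bit s (i - r) := by
  have h : Finset.Ico (i - r) i = insert (i - r : ℤ) (Finset.Ioo (i - r) i) := by
    ext p; simp only [Finset.mem_Ico, Finset.mem_insert, Finset.mem_Ioo]; omega
  rw [below, between, h, Finset.sum_insert (by simp), add_comm]

theorem below_succ_eq {r : ℕ} (hr : 1 ≤ r) (s : ℤ → Bool) (i : ℤ) :
    below r s (i + 1) = between r s i + bit s i := by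
  have h : Finset.Ico (i + 1 - r) (i + 1) = insert i (Finset.Ioo (i - r) i) := by
    ext p; simp only [Finset.mem_Ico, Finset.mem_insert, Finset.mem_Ioo]; omega
  rw [below, between, h, Finset.sum_insert (by simp), add_comm]

theorem between_hop_self (r : ℕ) (s : ℤ → Bool) (i : ℤ) :
    between r (hop r i s) i = between r s i := by
  refine Finset.sum_congr rfl fun p hp => ?_
  rw [Finset.mem_Ioo] at hp
  rw [bit, bit, hop_of_ne s (by omega) (by omega)]

theorem between_hop {r : ℕ} (hr : 1 ≤ r) {s : ℤ → Bool} {i : ℤ} (h₁ : s i = true)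
    (h₂ : s (i - r) = false) (j : ℤ) :
    between r (hop r i s) j + (if i ∈ Finset.Ioo (j - r) j then 1 else 0) =
      between r s j + (if i - r ∈ Finset.Ioo (j - r) j then 1 else 0) := by
  rw [between, between, ← Finset.sum_ite_eq' (Finset.Ioo (j - r) j) i (fun _ => 1),
    ← Finset.sum_ite_eq' (Finset.Ioo (j - r) j) (i - r) (fun _ => 1),
    ← Finset.sum_add_distrib, ← Finset.sum_add_distrib]
  refine Finset.sum_congr rfl fun p _ => ?_
  by_cases hp : p = i
  · subst hp
    rw [bit, bit, hop_right, h₁, h₂]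
    simp; omega
  · by_cases hp' : p = i - r
    · subst hp'
      rw [bit, bit, hop_left, h₁, h₂]
      simp; omega
    · rw [bit, bit, hop_of_ne s hp' hp]
      simp [hp, hp']

section Operators

variable {R : Type*} [CommRing R]

/-- Addition of a ribbon at position `i`, weighted by its height; as an operator on
functions of bit sequences. -/
noncomputable def addRibbon (r : ℕ) (τ : R) (i : ℤ) : Module.End R ((ℤ → Bool) → R) where
  toFun v t := if t i = true ∧ t (i - r) = false then τ ^ between r t i * v (hop r i t) else 0
  map_add' v w := by funext t; simp only [Pi.add_apply]; split_ifs <;> simp [mul_add]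
  map_smul' c v := by
    funext t; simp only [Pi.smul_apply, smul_eq_mul, RingHom.id_apply]; split_ifs <;> ring

/-- Removal of a ribbon at position `i`, weighted by its height. -/
noncomputable def removeRibbon (r : ℕ) (τ : R) (i : ℤ) : Module.End R ((ℤ → Bool) → R) where
  toFun v t := if t i = false ∧ t (i - r) = true then τ ^ between r t i * v (hop r i t) else 0
  map_add' v w := by funext t; simp only [Pi.add_apply]; split_ifs <;> simp [mul_add]
  map_smul' c v := by
    funext t; simp only [Pi.smul_apply, smul_eq_mul, RingHom.id_apply]; split_ifs <;> ring

/-- Multiplication by a function of the number of bits `1` just before `i`. -/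
noncomputable def belowMul (r : ℕ) (f : ℕ → R) (i : ℤ) : Module.End R ((ℤ → Bool) → R) where
  toFun v t := f (below r t i) * v t
  map_add' v w := by funext t; simp [mul_add]
  map_smul' c v := by funext t; simp only [Pi.smul_apply, smul_eq_mul, RingHom.id_apply]; ring

theorem addRibbon_apply (r : ℕ) (τ : R) (i : ℤ) (v : (ℤ → Bool) → R) (t : ℤ → Bool) :
    addRibbon r τ i v t =
      if t i = true ∧ t (i - r) = false then τ ^ between r t i * v (hop r i t) else 0 := rfl

theorem removeRibbon_apply (r : ℕ) (τ : R) (i : ℤ) (v : (ℤ → Bool) → R) (t : ℤ → Bool) :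
    removeRibbon r τ i v t =
      if t i = false ∧ t (i - r) = true then τ ^ between r t i * v (hop r i t) else 0 := rfl

theorem belowMul_apply (r : ℕ) (f : ℕ → R) (i : ℤ) (v : (ℤ → Bool) → R) (t : ℤ → Bool) :
    belowMul r f i v t = f (below r t i) * v t := rfl

theorem commute_removeRibbon_addRibbon {r : ℕ} (hr : 1 ≤ r) (τ : R) {i j : ℤ} (hij : i ≠ j) :
    Commute (removeRibbon r τ j) (addRibbon r τ i) := by
  refine LinearMap.ext fun v => funext fun t => ?_
  simp only [Module.End.mul_apply, addRibbon_apply, removeRibbon_apply]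
  by_cases h1 : j = i + r
  · subst h1
    have e : i + r - r = i := by ring
    have e₂ := hop_left r (i + r) t
    rw [e] at e₂
    rw [e, e₂, hop_right]
    split_ifs <;> simp_all
  by_cases h2 : j = i - r
  · subst h2
    rw [hop_right, hop_left]
    split_ifs <;> simp_all
  have hc : hop r i (hop r j t) = hop r j (hop r i t) := by
    funext p
    simp only [hop, Equiv.swap_apply_def]
    split_ifs <;> first | rfl | omega
  rw [hop_of_ne t (p := i) (i := j) (by omega) (by omega),
    hop_of_ne t (p := i - r) (i := j) (by omega) (by omega),
    hop_of_ne t (p := j) (i := i) (by omega) (by omega),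
    hop_of_ne t (p := j - r) (i := i) (by omega) (by omega), hc]
  by_cases hi : t i = true ∧ t (i - r) = false
  · by_cases hj : t j = false ∧ t (j - r) = true
    · rw [if_pos hi, if_pos hj, if_pos hi, if_pos hj, ← mul_assoc, ← mul_assoc, ← pow_add,
        ← pow_add]
      congr 2
      have b₁ := between_hop hr hi.1 hi.2 j
      have b₂ := between_hop (s := hop r j t) hr (i := j) (by rw [hop_right, hj.2])
        (by rw [hop_left, hj.1]) i
      rw [hop_hop] at b₂
      simp only [Finset.mem_Ioo] at b₁ b₂
      split_ifs at b₁ b₂ <;> omega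
    · simp [hj]
  · simp [hi]

/-- Addition and removal of a ribbon at one position, with the correction factors of the two
neighbouring windows. -/
theorem local_exchange {r : ℕ} (hr : 1 ≤ r) (τ x y : R) (f : ℕ → R)
    (hf : ∀ m, f (m + 1) = f m + x * y * τ ^ (2 * m) * f (m + 1)) (i : ℤ) :
    (1 + y • removeRibbon r τ i) * belowMul r f (i + 1) * (1 + x • addRibbon r τ i) =
      (1 + x • addRibbon r τ i) * belowMul r f i * (1 + y • removeRibbon r τ i) := by
  refine LinearMap.ext fun v => funext fun t => ?_
  simp only [Module.End.mul_apply, LinearMap.add_apply, LinearMap.smul_apply,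
    Module.End.one_apply, Pi.add_apply, Pi.smul_apply, addRibbon_apply, removeRibbon_apply,
    belowMul_apply, smul_eq_mul, below_succ_eq hr, between_hop_self, hop_right,
    hop_left, hop_hop, bit]
  have h := hf (between r t i)
  rw [below_eq hr, below_eq hr, between_hop_self, bit, bit, hop_left]
  cases h₁ : t i <;> cases h₂ : t (i - r) <;> simp
  · linear_combination (-v t) * h
  · linear_combination v t * h

/-- The generating operator (in `x`) for adding a horizontal ribbon strip with ribbons at the
positions `L, …, L + n - 1`. -/
noncomputable def addStrip (r : ℕ) (τ x : R) (L : ℤ) : ℕ → Module.End R ((ℤ → Bool) → R)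
  | 0 => 1
  | n + 1 => (1 + x • addRibbon r τ (L + n)) * addStrip r τ x L n

/-- The generating operator (in `y`) for removing a horizontal ribbon strip with ribbons at the
positions `L, …, L + n - 1`. -/
noncomputable def removeStrip (r : ℕ) (τ y : R) (L : ℤ) : ℕ → Module.End R ((ℤ → Bool) → R)
  | 0 => 1
  | n + 1 => removeStrip r τ y L n * (1 + y • removeRibbon r τ (L + n))

theorem commute_one_add_smul {A : Type*} [Ring A] [Algebra R A] {a b : A} (h : Commute a b)
    (x y : R) : Commute (1 + x • a) (1 + y • b) :=
  ((Commute.one_left _).add_left ((Commute.one_right _).add_right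
    ((h.smul_left x).smul_right y)))

theorem commute_removeStrip {r : ℕ} (hr : 1 ≤ r) (τ x y : R) (L : ℤ) (n : ℕ) {i : ℤ}
    (hi : L + n ≤ i) : Commute (removeStrip r τ y L n) (1 + x • addRibbon r τ i) := by
  induction n with
  | zero => exact Commute.one_left _
  | succ n ih =>
    push_cast at hi
    exact (ih (by omega)).mul_left
      (commute_one_add_smul (commute_removeRibbon_addRibbon hr τ (by omega)) _ _)

theorem commute_addStrip {r : ℕ} (hr : 1 ≤ r) (τ x y : R) (L : ℤ) (n : ℕ) {i : ℤ}
    (hi : L + n ≤ i) : Commute (1 + y • removeRibbon r τ i) (addStrip r τ x L n) := by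
  induction n with
  | zero => exact Commute.one_right _
  | succ n ih =>
    push_cast at hi
    exact (commute_one_add_smul (commute_removeRibbon_addRibbon hr τ (by omega)) _ _).mul_right
      (ih (by omega))

theorem removeStrip_mul_addStrip {r : ℕ} (hr : 1 ≤ r) (τ x y : R) (f : ℕ → R)
    (hf : ∀ m, f (m + 1) = f m + x * y * τ ^ (2 * m) * f (m + 1)) (L : ℤ) (n : ℕ) :
    removeStrip r τ y L n * belowMul r f (L + n) * addStrip r τ x L n =
      addStrip r τ x L n * belowMul r f L * removeStrip r τ y L n := by
  induction n with
  | zero => simp [addStrip, removeStrip]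
  | succ n ih =>
    have e : L + ((n + 1 : ℕ) : ℤ) = L + n + 1 := by push_cast; ring
    have c₁ := (commute_removeStrip hr τ x y L n le_rfl).eq
    have c₂ := (commute_addStrip hr τ x y L n le_rfl).eq
    have l := local_exchange hr τ x y f hf (L + n)
    rw [e, addStrip, removeStrip]
    set D := removeStrip r τ y L n
    set U := addStrip r τ x L n
    set u := 1 + x • addRibbon r τ (L + n)
    set d := 1 + y • removeRibbon r τ (L + n)
    calc D * d * belowMul r f (L + n + 1) * (u * U)
        = D * (d * belowMul r f (L + n + 1) * u) * U := by simp only [mul_assoc]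
      _ = (D * u) * belowMul r f (L + n) * (d * U) := by rw [l]; simp only [mul_assoc]
      _ = u * (D * belowMul r f (L + n) * U) * d := by rw [c₁, c₂]; simp only [mul_assoc]
      _ = u * U * belowMul r f L * (D * d) := by rw [ih]; simp only [mul_assoc]

end Operators

section Witness

variable {r : ℕ} {s t w : ℤ → ℕ}

theorem _root_.IsWitness.quad_iff (h : IsWitness r s t w) (i : ℤ) : Quad r s t w i ↔ s i ≠ w i := by
  constructor
  · rintro ⟨-, -, h₁, h₂⟩; omega
  · intro hne
    exact (h.1 i).resolve_left fun h' => hne h'.2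

theorem _root_.IsWitness.eq_upper (h : IsWitness r s t w) {i : ℤ} (hi : ¬ Quad r s t w (i + r)) :
    w i = t i := by
  have := (h.1 (i + r)).resolve_right hi
  simpa using this.1

theorem _root_.IsWitness.eq_lower (h : IsWitness r s t w) {i : ℤ} (hi : ¬ Quad r s t w i) :
    s i = w i := ((h.1 i).resolve_right hi).2

theorem _root_.IsWitness.exists_bound (h : IsWitness r s t w) :
    ∃ N : ℤ, ∀ i, N ≤ i → ¬ Quad r s t w i := by
  obtain ⟨N, hN⟩ := h.2.bddAbove
  exact ⟨N + 1, fun i hi hq => by have := hN hq; omega⟩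

theorem _root_.IsWitness.unique (hr : 1 ≤ r) {w' : ℤ → ℕ} (h : IsWitness r s t w)
    (h' : IsWitness r s t w') : w = w' := by
  obtain ⟨N, hN⟩ := h.exists_bound
  obtain ⟨N', hN'⟩ := h'.exists_bound
  have key : ∀ n : ℕ, ∀ i : ℤ, max N N' - n ≤ i → w i = w' i := by
    intro n
    induction n with
    | zero =>
      intro i hi
      rw [← h.eq_lower (hN i (by omega)), ← h'.eq_lower (hN' i (by omega))]
    | succ n ih =>
      intro i hi
      have e := ih (i + r) (by push_cast at hi; omega)
      by_cases hq : Quad r s t w (i + r)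
      · have hq' : Quad r s t w' (i + r) := by
          rw [h'.quad_iff, ← e, ← h.quad_iff]; exact hq
        have h₁ := hq.1
        have h₂ := hq'.1
        simp only [add_sub_cancel_right] at h₁ h₂
        rw [h₁, h₂]
      · have hq' : ¬ Quad r s t w' (i + r) := by
          rw [h'.quad_iff, ← e, ← h.quad_iff]; exact hq
        rw [h.eq_upper hq, h'.eq_upper hq']
  funext i
  exact key (max N N' - i).toNat i (by omega)

theorem _root_.IsWitness.theWitness_eq (hr : 1 ≤ r) (h : IsWitness r s t w) :
    theWitness r s t = w := by
  have hs : HStrip r s t := ⟨w, h⟩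
  rw [theWitness, dif_pos hs]
  exact IsWitness.unique hr hs.choose_spec h

theorem _root_.IsWitness.ribCount_eq (hr : 1 ≤ r) (h : IsWitness r s t w) :
    ribCount r s t = {i | Quad r s t w i}.ncard := by
  simp only [ribCount, RibbonAt, h.theWitness_eq hr]

theorem _root_.IsWitness.twoSpin_eq (hr : 1 ≤ r) (h : IsWitness r s t w) :
    twoSpin r s t = ∑ᶠ i ∈ {i | Quad r s t w i}, hgtAt r w i := by
  simp only [twoSpin, RibbonAt, h.theWitness_eq hr]

theorem _root_.IsWitness.eq_of_not_quad (h : IsWitness r s t w) (hq : ∀ i, ¬ Quad r s t w i) :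
    s = t := funext fun i => (h.eq_lower (hq i)).trans (h.eq_upper (hq _))

theorem isWitness_self (r : ℕ) (s : ℤ → ℕ) : IsWitness r s s s := by
  refine ⟨fun i => Or.inl ⟨rfl, rfl⟩, ?_⟩
  convert Set.finite_empty
  ext i
  simp only [Set.mem_ofPred_eq, Set.mem_empty_iff_false, iff_false]
  rintro ⟨-, -, h₁, h₂⟩; omega

end Witness

/-- `w` is a witness for `t/s` being a horizontal `r`-ribbon strip with all its ribbons at the
positions `L, …, L + n - 1`. -/
def WitnessIn (r : ℕ) (L : ℤ) (n : ℕ) (s t : ℤ → Bool) (w : ℤ → ℕ) : Prop :=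
  IsWitness r (bit s) (bit t) w ∧ ∀ i, Quad r (bit s) (bit t) w i → L ≤ i ∧ i < L + n

theorem bit_eq_one {s : ℤ → Bool} {i : ℤ} : bit s i = 1 ↔ s i = true := by
  cases h : s i <;> simp [bit, h]

theorem bit_eq_zero {s : ℤ → Bool} {i : ℤ} : bit s i = 0 ↔ s i = false := by
  cases h : s i <;> simp [bit, h]

theorem bit_inj {s t : ℤ → Bool} {i : ℤ} : bit s i = bit t i ↔ s i = t i := by
  cases h : s i <;> cases h' : t i <;> simp [bit, h, h']

theorem bit_injective : Function.Injective bit :=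
  fun _ _ h => funext fun i => bit_inj.1 (congrFun h i)

section Steps

variable {r : ℕ} {L : ℤ} {n : ℕ} {s t : ℤ → Bool} {w : ℤ → ℕ}

theorem WitnessIn.eq_above (h : WitnessIn r L n s t w) {i : ℤ} (hi : L + n ≤ i) : s i = t i := by
  rw [← bit_inj, h.1.eq_lower fun hq => by have := h.2 _ hq; omega,
    h.1.eq_upper fun hq => by have := h.2 _ hq; omega]

theorem quad_hop (hr : 1 ≤ r) {i : ℤ} (hw : w i = 0) (hw' : w (i - r) = 1) (ht : t i = false)
    (ht' : t (i - r) = true) (hs : s i = false) (hs' : bit s (i + r) = w (i + r)) :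
    (∀ k, (Quad r (bit s) (bit (hop r i t)) (Function.update w i 1) k ↔
      k = i ∨ Quad r (bit s) (bit t) w k)) ∧ ¬ Quad r (bit s) (bit t) w i ∧
    ((∀ k, (w (k - r) = bit t (k - r) ∧ bit s k = w k) ∨ Quad r (bit s) (bit t) w k) ↔
      ∀ k, (Function.update w i 1 (k - r) = bit (hop r i t) (k - r) ∧
        bit s k = Function.update w i 1 k) ∨
        Quad r (bit s) (bit (hop r i t)) (Function.update w i 1) k) := by
  have b₁ : bit (hop r i t) i = 1 := by rw [bit_eq_one, hop_right, ht']
  have b₂ : bit (hop r i t) (i - r) = 0 := by rw [bit_eq_zero, hop_left, ht]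
  have b₃ : ∀ k, k ≠ i → k ≠ i - r → bit (hop r i t) k = bit t k := fun k h h' => by
    rw [bit_inj, hop_of_ne t h' h]
  have b₄ := bit_eq_zero.2 hs
  have b₅ := bit_eq_zero.2 ht
  have b₆ := bit_eq_one.2 ht'
  have u₁ : Function.update w i 1 i = 1 := by simp
  have u₂ : ∀ k, k ≠ i → Function.update w i 1 k = w k := fun k h => by simp [h]
  have q : ∀ k, (Quad r (bit s) (bit (hop r i t)) (Function.update w i 1) k ↔
      k = i ∨ Quad r (bit s) (bit t) w k) := by
    intro k
    by_cases hk : k = i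
    · subst hk
      simp only [Quad, u₁, u₂ (k - r) (by omega), hw', b₂, b₄, true_or, and_self]
    · by_cases hk' : k = i + r
      · subst hk'
        simp only [Quad, add_sub_cancel_right, u₁, b₁, hk, hw]
        simp
      · simp only [Quad, u₂ (k - r) (by omega), u₂ k hk, b₃ (k - r) (by omega) (by omega), hk,
          false_or]
  have q' : ¬ Quad r (bit s) (bit t) w i := by rintro ⟨-, -, -, h⟩; omega
  refine ⟨q, q', forall_congr' fun k => ?_⟩
  rw [q]
  by_cases hk : k = i
  · subst hk
    simp [b₆, hw', hw, b₄]
  · by_cases hk' : k = i + r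
    · subst hk'
      simp only [add_sub_cancel_right, u₁, b₁, hw, b₅, u₂ _ hk, hs', true_and, true_or]
    · simp only [u₂ (k - r) (by omega), u₂ k hk, b₃ (k - r) (by omega) (by omega), hk, false_or]

theorem WitnessIn.hop (hr : 1 ≤ r) (h : WitnessIn r L n s t w) (h₁ : t (L + n) = false)
    (h₂ : t (L + n - r) = true) :
    WitnessIn r L (n + 1) s (hop r (L + n) t) (Function.update w (L + n) 1) ∧
    {k | Quad r (bit s) (bit (RibbonStrip.hop r (L + n) t)) (Function.update w (L + n) 1) k} =
      insert (L + n : ℤ) {k | Quad r (bit s) (bit t) w k} := by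
  have nq : ∀ k, L + n ≤ k → ¬ Quad r (bit s) (bit t) w k := fun k hk hq => by
    have := h.2 _ hq; omega
  have hs := h.eq_above (i := L + n) le_rfl
  obtain ⟨q, -, c⟩ := quad_hop (s := s) (t := t) (w := w) (i := L + n) hr
    (by rw [← h.1.eq_lower (nq _ le_rfl), bit_eq_zero, hs, h₁])
    (by rw [h.1.eq_upper (nq _ (by omega)), bit_eq_one, h₂]) h₁ h₂ (hs.trans h₁)
    (h.1.eq_lower (nq _ (by omega)))
  have e : {k | Quad r (bit s) (bit (RibbonStrip.hop r (L + n) t))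
      (Function.update w (L + n) 1) k} = insert (L + n : ℤ) {k | Quad r (bit s) (bit t) w k} := by
    ext k; exact q k
  refine ⟨⟨⟨c.1 h.1.1, ?_⟩, fun k hk => ?_⟩, e⟩
  · rw [e]; exact h.1.2.insert _
  · rcases (q k).1 hk with rfl | hk
    · push_cast; omega
    · have := h.2 k hk; push_cast; omega

theorem WitnessIn.exists_of_quad (hr : 1 ≤ r) (h : WitnessIn r L (n + 1) s t w)
    (hq : Quad r (bit s) (bit t) w (L + n)) :
    t (L + n) = true ∧ t (L + n - r) = false ∧ s (L + n) = false ∧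
      ∃ w', WitnessIn r L n s (RibbonStrip.hop r (L + n) t) w' := by
  have nq : ∀ k, L + n + 1 ≤ k → ¬ Quad r (bit s) (bit t) w k := fun k hk hq => by
    have := h.2 _ hq; push_cast at this; omega
  obtain ⟨q₁, q₂, q₃, q₄⟩ := hq
  have h₁ : t (L + n) = true := by
    rw [← bit_eq_one, ← h.1.eq_upper (nq _ (by omega)), q₄]
  have h₂ := bit_eq_zero.1 q₂
  have h₃ := bit_eq_zero.1 q₃
  refine ⟨h₁, h₂, h₃, Function.update w (L + n) 0, ?_⟩
  obtain ⟨q, q', c⟩ := quad_hop (s := s) (t := RibbonStrip.hop r (L + n) t)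
    (w := Function.update w (L + n) 0) (i := L + n) hr (by simp)
    (by rw [Function.update_of_ne (by omega), q₁]) (by rw [hop_right, h₂])
    (by rw [hop_left, h₁]) h₃
    (by rw [Function.update_of_ne (by omega), h.1.eq_lower (nq _ (by omega))])
  have e : Function.update (Function.update w (L + n) 0) (L + n) 1 = w := by
    rw [Function.update_idem, ← q₄, Function.update_eq_self]
  rw [e, hop_hop] at q c
  refine ⟨⟨c.2 h.1.1, h.1.2.subset fun k hk => (q k).2 (Or.inr hk)⟩, fun k hk => ?_⟩
  have h₄ := h.2 k ((q k).2 (Or.inr hk))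
  have : k ≠ L + n := fun h => q' (h ▸ hk)
  push_cast at h₄
  omega

theorem WitnessIn.succ (h : WitnessIn r L n s t w) : WitnessIn r L (n + 1) s t w :=
  ⟨h.1, fun i hi => by have := h.2 i hi; push_cast; omega⟩

theorem WitnessIn.of_not_quad (h : WitnessIn r L (n + 1) s t w)
    (hq : ¬ Quad r (bit s) (bit t) w (L + n)) : WitnessIn r L n s t w :=
  ⟨h.1, fun i hi => by
    have := h.2 i hi
    have : i ≠ L + n := fun e => hq (e ▸ hi)
    push_cast at *; omega⟩

theorem hgtAt_eq_sum (r : ℕ) (w : ℤ → ℕ) (i : ℤ) :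
    hgtAt r w i = ∑ p ∈ Finset.Ioo (i - r) i, w p := by
  rw [hgtAt]
  refine Finset.sum_bij' (fun j _ => i - (j : ℤ)) (fun p _ => (i - p).toNat) ?_ ?_ ?_ ?_ ?_
  all_goals simp only [Finset.mem_Ico, Finset.mem_Ioo]
  all_goals intros
  all_goals first | omega | simp

theorem WitnessIn.ribCount_hop (hr : 1 ≤ r) (h : WitnessIn r L n s t w)
    (h₁ : t (L + n) = false) (h₂ : t (L + n - r) = true) :
    ribCount r (bit s) (bit (RibbonStrip.hop r (L + n) t)) = ribCount r (bit s) (bit t) + 1 := by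
  obtain ⟨h', e⟩ := h.hop hr h₁ h₂
  rw [h'.1.ribCount_eq hr, h.1.ribCount_eq hr, e, Set.ncard_insert_of_notMem _ h.1.2]
  intro hq
  have := h.2 _ hq
  omega

theorem WitnessIn.twoSpin_hop (hr : 1 ≤ r) (h : WitnessIn r L n s t w)
    (h₁ : t (L + n) = false) (h₂ : t (L + n - r) = true) :
    twoSpin r (bit s) (bit (RibbonStrip.hop r (L + n) t)) =
      between r t (L + n) + twoSpin r (bit s) (bit t) := by
  obtain ⟨h', e⟩ := h.hop hr h₁ h₂
  have nm : (L + n : ℤ) ∉ {k | Quad r (bit s) (bit t) w k} := fun hq => by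
    have := h.2 _ hq
    omega
  rw [h'.1.twoSpin_eq hr, h.1.twoSpin_eq hr, e, finsum_mem_insert _ nm h.1.2]
  congr 1
  · rw [hgtAt_eq_sum, between]
    refine Finset.sum_congr rfl fun p hp => ?_
    rw [Finset.mem_Ioo] at hp
    rw [Function.update_of_ne (by omega), h.1.eq_upper fun hq => by have := h.2 _ hq; omega]
  · refine finsum_mem_congr rfl fun k hk => ?_
    have := h.2 k hk
    rw [hgtAt_eq_sum, hgtAt_eq_sum]
    refine Finset.sum_congr rfl fun p hp => ?_
    rw [Finset.mem_Ioo] at hp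
    rw [Function.update_of_ne (by omega)]

end Steps

section Support

variable {r : ℕ} {s t : ℤ → Bool} {w : ℤ → ℕ}

theorem _root_.IsWitness.quad_bounds (hr : 1 ≤ r) (h : IsWitness r (bit s) (bit t) w) {a b : ℤ}
    {K : ℕ} (ha : ∀ i < a, s i = true) (hb : ∀ i, b ≤ i → s i = false)
    (hK : {i | Quad r (bit s) (bit t) w i}.ncard ≤ K) {i : ℤ}
    (hi : Quad r (bit s) (bit t) w i) : a ≤ i ∧ i < b + r * K := by
  constructor
  · by_contra! hlt
    have h₁ := bit_eq_zero.1 hi.2.2.1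
    rw [ha i hlt] at h₁
    simp at h₁
  · by_contra! hle
    have hq : ∀ k : ℕ, k ≤ K → Quad r (bit s) (bit t) w (i - r * k) := by
      intro k
      induction k with
      | zero => intro _; simpa using hi
      | succ k ih =>
        intro hk
        have h₁ := (ih (by omega)).1
        have e : i - (r : ℤ) * k - r = i - r * (k + 1 : ℕ) := by push_cast; ring
        rw [e] at h₁
        have hge : b ≤ i - r * (k + 1 : ℕ) := by
          have : (r : ℤ) * (k + 1 : ℕ) ≤ r * K := by gcongr
          omega
        rw [h.quad_iff, bit_eq_zero.2 (hb _ hge), h₁]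
        simp
    have hsub : (fun k : ℕ => i - (r : ℤ) * k) '' (Finset.range (K + 1) : Set ℕ) ⊆
        {i | Quad r (bit s) (bit t) w i} := by
      rintro _ ⟨k, hk, rfl⟩
      exact hq k (by simpa [Nat.lt_succ_iff] using hk)
    have hcard := Set.ncard_le_ncard hsub h.2
    rw [Set.ncard_image_of_injective, Set.ncard_coe_finset, Finset.card_range] at hcard
    · omega
    · intro k k' hkk
      have : (r : ℤ) * k = r * k' := by simpa using hkk
      have hr' : (r : ℤ) ≠ 0 := by omega
      exact_mod_cast mul_left_cancel₀ hr' this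

theorem _root_.IsWitness.eq_true_of_lt (h : IsWitness r (bit s) (bit t) w) {a : ℤ}
    (ha : ∀ i < a, s i = true) : ∀ i < a - r, t i = true := by
  intro i hi
  have nq : ∀ k < a, ¬ Quad r (bit s) (bit t) w k := fun k hk hq => by
    have := bit_eq_zero.1 hq.2.2.1
    rw [ha k hk] at this
    simp at this
  rw [← bit_eq_one, ← h.eq_upper (nq _ (by omega)), ← h.eq_lower (nq _ (by omega)), bit_eq_one]
  exact ha i (by omega)

theorem _root_.IsWitness.eq_false_of_le (hr : 1 ≤ r) (h : IsWitness r (bit s) (bit t) w) {b : ℤ}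
    {K : ℕ} {a : ℤ} (ha : ∀ i < a, s i = true) (hb : ∀ i, b ≤ i → s i = false)
    (hK : {i | Quad r (bit s) (bit t) w i}.ncard ≤ K) :
    ∀ i, b + r * K ≤ i → t i = false := by
  intro i hi
  have nq : ∀ k, b + r * K ≤ k → ¬ Quad r (bit s) (bit t) w k := fun k hk hq => by
    have := h.quad_bounds hr ha hb hK hq
    omega
  have hb' : b ≤ i := by nlinarith
  rw [← bit_eq_zero, ← h.eq_upper (nq _ (by omega)), ← h.eq_lower (nq _ hi), bit_eq_zero]
  exact hb i hb'

end Support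

section Kernel

variable {R : Type*} [CommRing R]

/-- The weight of the strip `t/s` if it is a horizontal `r`-ribbon strip with ribbons at the
positions `L, …, L + n - 1`, and `0` otherwise. -/
noncomputable def stripWeight (r : ℕ) (τ x : R) (L : ℤ) (n : ℕ) (s t : ℤ → Bool) : R :=
  if ∃ w, WitnessIn r L n s t w then
    x ^ ribCount r (bit s) (bit t) * τ ^ twoSpin r (bit s) (bit t) else 0

theorem witnessIn_zero_iff {r : ℕ} {L : ℤ} {s t : ℤ → Bool} :
    (∃ w, WitnessIn r L 0 s t w) ↔ s = t := by
  constructor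
  · rintro ⟨w, h⟩
    exact bit_injective (h.1.eq_of_not_quad fun i hi => by have := h.2 i hi; simp at this; omega)
  · rintro rfl
    refine ⟨bit s, isWitness_self r _, ?_⟩
    rintro i ⟨-, -, h₁, h₂⟩; omega

theorem not_quad_self {r : ℕ} {s : ℤ → ℕ} {i : ℤ} : ¬ Quad r s s s i := by
  rintro ⟨-, -, h₁, h₂⟩; omega

theorem ribCount_self {r : ℕ} (hr : 1 ≤ r) (s : ℤ → ℕ) : ribCount r s s = 0 := by
  rw [(isWitness_self r s).ribCount_eq hr]
  simp [not_quad_self]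

theorem twoSpin_self {r : ℕ} (hr : 1 ≤ r) (s : ℤ → ℕ) : twoSpin r s s = 0 := by
  rw [(isWitness_self r s).twoSpin_eq hr]
  simp [not_quad_self]

theorem stripWeight_zero {r : ℕ} (hr : 1 ≤ r) (τ x : R) (L : ℤ) (s t : ℤ → Bool) :
    stripWeight r τ x L 0 s t = if s = t then 1 else 0 := by
  simp only [stripWeight, witnessIn_zero_iff]
  split_ifs with h
  · subst h
    simp [ribCount_self hr, twoSpin_self hr]
  · rfl

theorem stripWeight_succ {r : ℕ} (hr : 1 ≤ r) (τ x : R) (L : ℤ) (n : ℕ) (s t : ℤ → Bool) :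
    stripWeight r τ x L (n + 1) s t = stripWeight r τ x L n s t +
      if t (L + n) = true ∧ t (L + n - r) = false then
        x * (τ ^ between r t (L + n) * stripWeight r τ x L n s (hop r (L + n) t)) else 0 := by
  by_cases hc : t (L + n) = true ∧ t (L + n - r) = false ∧ s (L + n) = false
  · obtain ⟨h₁, h₂, h₃⟩ := hc
    have e₀ : stripWeight r τ x L n s t = 0 := by
      rw [stripWeight, if_neg]
      rintro ⟨w, hw⟩
      have := hw.eq_above le_rfl
      simp_all
    rw [e₀, zero_add, if_pos ⟨h₁, h₂⟩]
    have hiff : (∃ w, WitnessIn r L (n + 1) s t w) ↔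
        ∃ w, WitnessIn r L n s (hop r (L + n) t) w := by
      constructor
      · rintro ⟨w, hw⟩
        by_cases hq : Quad r (bit s) (bit t) w (L + n)
        · exact (hw.exists_of_quad hr hq).2.2.2
        · have := (hw.of_not_quad hq).eq_above le_rfl
          simp_all
      · rintro ⟨w, hw⟩
        have := (hw.hop hr (by rw [hop_right, h₂]) (by rw [hop_left, h₁])).1
        rw [hop_hop] at this
        exact ⟨_, this⟩
    simp only [stripWeight, hiff]
    split_ifs with hw
    · obtain ⟨w, hw⟩ := hw
      have c₁ := hw.ribCount_hop hr (by rw [hop_right, h₂]) (by rw [hop_left, h₁])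
      have c₂ := hw.twoSpin_hop hr (by rw [hop_right, h₂]) (by rw [hop_left, h₁])
      rw [hop_hop] at c₁ c₂
      rw [c₁, c₂, between_hop_self]
      ring
    · simp
  · have hiff : (∃ w, WitnessIn r L (n + 1) s t w) ↔ ∃ w, WitnessIn r L n s t w := by
      refine exists_congr fun w => ⟨fun hw => hw.of_not_quad fun hq => hc ?_, fun hw => hw.succ⟩
      have := hw.exists_of_quad hr hq
      exact ⟨this.1, this.2.1, this.2.2.1⟩
    have e : (if t (L + n) = true ∧ t (L + n - r) = false then
        x * (τ ^ between r t (L + n) * stripWeight r τ x L n s (hop r (L + n) t)) else 0) = 0 := by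
      split_ifs with h
      · rw [stripWeight, if_neg, mul_zero, mul_zero]
        rintro ⟨w, hw⟩
        have := hw.eq_above le_rfl
        rw [hop_right, h.2] at this
        exact hc ⟨h.1, h.2, this⟩
      · rfl
    rw [e, add_zero]
    simp only [stripWeight, hiff]

/-- The bit sequences that agree with `g` outside the interval `[A, B)`. -/
noncomputable def box (g : ℤ → Bool) (A B : ℤ) : Finset (ℤ → Bool) :=
  (Finset.Ico A B).powerset.image fun P p => if p ∈ Finset.Ico A B then decide (p ∈ P) else g p

theorem mem_box {g : ℤ → Bool} {A B : ℤ} {s : ℤ → Bool} :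
    s ∈ box g A B ↔ ∀ p, p ∉ Finset.Ico A B → s p = g p := by
  simp only [box, Finset.mem_image, Finset.mem_powerset]
  constructor
  · rintro ⟨P, -, rfl⟩ p hp
    simp [hp]
  · intro h
    refine ⟨(Finset.Ico A B).filter fun p => s p = true, Finset.filter_subset _ _, ?_⟩
    funext p
    by_cases hp : p ∈ Finset.Ico A B
    · rw [if_pos hp]
      simp only [Finset.mem_filter, hp, true_and, Bool.decide_eq_true]
    · rw [if_neg hp, h p hp]

theorem self_mem_box (g : ℤ → Bool) (A B : ℤ) : g ∈ box g A B := mem_box.2 fun _ _ => rfl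

theorem hop_mem_box {g : ℤ → Bool} {A B : ℤ} {s : ℤ → Bool} {r : ℕ} {i : ℤ} (hA : A ≤ i - r)
    (hB : i < B) (hs : s ∈ box g A B) : hop r i s ∈ box g A B := by
  rw [mem_box] at hs ⊢
  intro p hp
  have hp' := hp
  rw [Finset.mem_Ico] at hp'
  rw [hop_of_ne s (by omega) (by omega), hs p hp]

theorem addStrip_apply {r : ℕ} (hr : 1 ≤ r) (τ x : R) (L : ℤ) (n : ℕ) {g : ℤ → Bool} {A B : ℤ}
    (hA : A ≤ L - r) (hB : L + n ≤ B) (v : (ℤ → Bool) → R) {t : ℤ → Bool}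
    (ht : t ∈ box g A B) :
    addStrip r τ x L n v t = ∑ s ∈ box g A B, stripWeight r τ x L n s t * v s := by
  induction n generalizing t with
  | zero => simp [addStrip, stripWeight_zero hr, ht]
  | succ n ih =>
    push_cast at hB
    have ht' : hop r (L + n) t ∈ box g A B := hop_mem_box (by omega) (by omega) ht
    simp only [addStrip, Module.End.mul_apply, LinearMap.add_apply, LinearMap.smul_apply,
      Module.End.one_apply, Pi.add_apply, Pi.smul_apply, addRibbon_apply, smul_eq_mul,
      stripWeight_succ hr, add_mul, Finset.sum_add_distrib]
    rw [ih (by omega) ht, ih (by omega) ht']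
    congr 1
    split_ifs
    · rw [Finset.mul_sum, Finset.mul_sum]
      exact Finset.sum_congr rfl fun s _ => by ring
    · simp

theorem removeStrip_apply {r : ℕ} (hr : 1 ≤ r) (τ y : R) (L : ℤ) (n : ℕ) {g : ℤ → Bool} {A B : ℤ}
    (hA : A ≤ L - r) (hB : L + n ≤ B) (v : (ℤ → Bool) → R) {s : ℤ → Bool}
    (hs : s ∈ box g A B) :
    removeStrip r τ y L n v s = ∑ t ∈ box g A B, stripWeight r τ y L n s t * v t := by
  induction n generalizing v with
  | zero => simp [removeStrip, stripWeight_zero hr, hs]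
  | succ n ih =>
    push_cast at hB
    have hm : ∀ t ∈ box g A B, hop r (L + n) t ∈ box g A B := fun t ht =>
      hop_mem_box (by omega) (by omega) ht
    simp only [removeStrip, Module.End.mul_apply, stripWeight_succ hr, add_mul,
      Finset.sum_add_distrib]
    rw [ih (by omega)]
    simp only [LinearMap.add_apply, LinearMap.smul_apply,
      Module.End.one_apply, Pi.add_apply, Pi.smul_apply, removeRibbon_apply, smul_eq_mul,
      mul_add, Finset.sum_add_distrib]
    congr 1
    refine Finset.sum_nbij' (hop r (L + n)) (hop r (L + n)) hm hm (fun t _ => hop_hop r _ t)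
      (fun t _ => hop_hop r _ t) fun t _ => ?_
    rw [hop_right, hop_left, between_hop_self, hop_hop]
    by_cases h : t (L + n) = false ∧ t (L + n - r) = true
    · rw [if_pos h, if_pos h.symm]; ring
    · rw [if_neg h, if_neg fun h' => h h'.symm]; ring

end Kernel

/-- The edge sequence of a partition as a `Bool`-valued function. -/
noncomputable def edge (f : ℕ → ℕ) : ℤ → Bool :=
  fun k => decide (∃ j : ℕ, (f j : ℤ) - j - 1 = k)

theorem bit_edge (f : ℕ → ℕ) : bit (edge f) = edgeSeq f := by
  funext k
  simp only [bit, edge, edgeSeq]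
  split_ifs with h <;> simp [h]

theorem edge_eq_true {f : ℕ → ℕ} {k : ℤ} : edge f k = true ↔ ∃ j : ℕ, (f j : ℤ) - j - 1 = k := by
  simp [edge]

theorem edge_eq_false {f : ℕ → ℕ} {k : ℤ} :
    edge f k = false ↔ ∀ j : ℕ, (f j : ℤ) - j - 1 ≠ k := by
  simp [edge]

theorem _root_.IsPartition.of_succ_le {f : ℕ → ℕ} (h : ∀ i, f (i + 1) ≤ f i) {N : ℕ}
    (hN : ∀ n, N ≤ n → f n = 0) : IsPartition f :=
  ⟨fun _ _ hij => antitone_nat_of_succ_le h hij, N, hN⟩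

theorem _root_.IsPartition.pos_inj {f : ℕ → ℕ} (hf : IsPartition f) {i j : ℕ}
    (h : (f i : ℤ) - i - 1 = f j - j - 1) : i = j := by
  rcases lt_trichotomy i j with hij | hij | hij
  · have := hf.1 i j hij.le; omega
  · exact hij
  · have := hf.1 j i hij.le; omega

theorem edge_injective {f g : ℕ → ℕ} (hf : IsPartition f) (hg : IsPartition g)
    (h : edge f = edge g) : f = g := by
  have key : ∀ {f g : ℕ → ℕ}, IsPartition f → IsPartition g → edge f = edge g →
      ∀ j, (∀ i < j, f i = g i) → g j ≤ f j := by
    intro f g hf hg h j ih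
    by_contra! hlt
    have : edge f (g j - j - 1) = true := by rw [h, edge_eq_true]; exact ⟨j, rfl⟩
    obtain ⟨i, hi⟩ := edge_eq_true.1 this
    have hij : i < j := by
      by_contra! hle
      have := hf.1 j i hle
      omega
    have h₁ := ih i hij
    have h₂ := hg.1 i j hij.le
    omega
  funext j
  induction j using Nat.strong_induction_on with
  | _ j ih =>
    exact le_antisymm (key hg hf h.symm j fun i hi => (ih i hi).symm) (key hf hg h j ih)

theorem edge_swap_of_pos {f g : ℕ → ℕ} {k : ℤ}
    (h : ∀ j, (g j : ℤ) - j - 1 = Equiv.swap (k - 1) k (f j - j - 1)) :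
    edge g = fun p => edge f (Equiv.swap (k - 1) k p) := by
  funext p
  rw [Bool.eq_iff_iff, edge_eq_true, edge_eq_true]
  refine exists_congr fun j => ?_
  rw [h, Equiv.swap_apply_eq_iff]

theorem exists_edge_swap_succ {f : ℕ → ℕ} (hf : IsPartition f) (k : ℤ) :
    ∃ g, IsPartition g ∧ edge g = fun p => edge f (Equiv.swap (k - 1) k p) := by
  obtain ⟨N, hN⟩ := hf.2
  rcases h₁ : edge f (k - 1) with _ | _ <;> rcases h₂ : edge f k with _ | _
  · refine ⟨f, hf, edge_swap_of_pos fun j => ?_⟩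
    rw [Equiv.swap_apply_of_ne_of_ne (edge_eq_false.1 h₁ j) (edge_eq_false.1 h₂ j)]
  · obtain ⟨j, hj⟩ := edge_eq_true.1 h₂
    have n₁ := edge_eq_false.1 h₁ (j + 1)
    have m₁ := hf.1 j (j + 1) (by omega)
    push_cast at n₁
    refine ⟨Function.update f j (f j - 1), IsPartition.of_succ_le (N := max N (j + 1)) ?_ ?_,
      edge_swap_of_pos fun i => ?_⟩
    · intro i
      have m₂ := hf.1 i (i + 1) (by omega)
      by_cases hi : i = j
      · subst hi
        rw [Function.update_self, Function.update_of_ne (by omega)]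
        omega
      · rw [Function.update_of_ne hi]
        by_cases hi' : i + 1 = j
        · subst hi'
          rw [Function.update_self]
          omega
        · rw [Function.update_of_ne hi']
          exact m₂
    · intro n hn
      rw [Function.update_of_ne (by omega)]
      exact hN n (by omega)
    · by_cases hi : i = j
      · subst hi
        rw [Function.update_self, hj, Equiv.swap_apply_right]
        omega
      · rw [Function.update_of_ne hi, Equiv.swap_apply_of_ne_of_ne (edge_eq_false.1 h₁ i)]
        exact fun h => hi (hf.pos_inj (h.trans hj.symm))
  · obtain ⟨j, hj⟩ := edge_eq_true.1 h₁
    refine ⟨Function.update f j (f j + 1), IsPartition.of_succ_le (N := max N (j + 1)) ?_ ?_,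
      edge_swap_of_pos fun i => ?_⟩
    · intro i
      have m₂ := hf.1 i (i + 1) (by omega)
      by_cases hi : i = j
      · subst hi
        rw [Function.update_self, Function.update_of_ne (by omega)]
        omega
      · rw [Function.update_of_ne hi]
        by_cases hi' : i + 1 = j
        · subst hi'
          rw [Function.update_self]
          have := edge_eq_false.1 h₂ i
          push_cast at hj
          omega
        · rw [Function.update_of_ne hi']
          exact m₂
    · intro n hn
      rw [Function.update_of_ne (by omega)]
      exact hN n (by omega)
    · by_cases hi : i = j
      · subst hi
        rw [Function.update_self, hj, Equiv.swap_apply_left]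
        push_cast
        omega
      · rw [Function.update_of_ne hi, Equiv.swap_apply_of_ne_of_ne _ (edge_eq_false.1 h₂ i)]
        exact fun h => hi (hf.pos_inj (h.trans hj.symm))
  · refine ⟨f, hf, funext fun p => ?_⟩
    by_cases hp : p = k
    · subst hp; rw [Equiv.swap_apply_right, h₁, h₂]
    · by_cases hp' : p = k - 1
      · subst hp'; rw [Equiv.swap_apply_left, h₁, h₂]
      · rw [Equiv.swap_apply_of_ne_of_ne hp' hp]

theorem exists_edge_hop {f : ℕ → ℕ} (hf : IsPartition f) (r : ℕ) (i : ℤ) :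
    ∃ g, IsPartition g ∧ edge g = hop r i (edge f) := by
  induction r generalizing i f with
  | zero => exact ⟨f, hf, by funext p; simp [hop]⟩
  | succ r ih =>
    obtain ⟨g₁, hg₁, e₁⟩ := exists_edge_swap_succ hf i
    obtain ⟨g₂, hg₂, e₂⟩ := ih hg₁ (i - 1)
    obtain ⟨g₃, hg₃, e₃⟩ := exists_edge_swap_succ hg₂ i
    by_cases hr : r = 0
    · subst hr
      exact ⟨g₁, hg₁, by rw [e₁]; funext p; simp [hop]⟩
    refine ⟨g₃, hg₃, ?_⟩
    rw [e₃, e₂]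
    funext p
    simp only [hop, e₁]
    congr 1
    have e : i - ((r + 1 : ℕ) : ℤ) = i - 1 - r := by push_cast; ring
    rw [e]
    simp only [Equiv.swap_apply_def]
    split_ifs <;> omega

theorem WitnessIn.exists_edge {r : ℕ} (hr : 1 ≤ r) {L : ℤ} {n : ℕ} {f : ℕ → ℕ}
    (hf : IsPartition f) {t : ℤ → Bool} {w : ℤ → ℕ} (h : WitnessIn r L n (edge f) t w) :
    ∃ g, IsPartition g ∧ edge g = t := by
  induction n generalizing t w with
  | zero => exact ⟨f, hf, witnessIn_zero_iff.1 ⟨w, h⟩⟩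
  | succ n ih =>
    by_cases hq : Quad r (bit (edge f)) (bit t) w (L + n)
    · obtain ⟨-, -, -, w', hw'⟩ := h.exists_of_quad hr hq
      obtain ⟨g, hg, e⟩ := ih hw'
      obtain ⟨g', hg', e'⟩ := exists_edge_hop hg r (L + n)
      exact ⟨g', hg', by rw [e', e, hop_hop]⟩
    · exact ih (h.of_not_quad hq)

theorem _root_.IsPartition.exists_bound {f : ℕ → ℕ} (hf : IsPartition f) :
    ∃ B : ℕ, (∀ i < -(B : ℤ), edge f i = true) ∧ ∀ i, (B : ℤ) ≤ i → edge f i = false := by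
  obtain ⟨N, hN⟩ := hf.2
  refine ⟨N + f 0, fun i hi => edge_eq_true.2 ⟨(-i - 1).toNat, ?_⟩,
    fun i hi => edge_eq_false.2 fun j => ?_⟩
  · rw [hN _ (by omega)]; omega
  · have := hf.1 0 j (by omega); omega

section Eigenvector

variable {R : Type*} [CommRing R]

/-- The sequence of vectors obtained from the indicator function of `g` by adding strips. -/
noncomputable def addIter (r : ℕ) (τ : R) (x : ℕ → R) (L : ℤ) (N : ℕ) (g : ℤ → Bool) :
    ℕ → (ℤ → Bool) → R
  | 0 => Pi.single g 1
  | m + 1 => addStrip r τ (x m) L N (addIter r τ x L N g m)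

/-- The operator removing `m` successive strips. -/
noncomputable def removeIter (r : ℕ) (τ : R) (y : ℕ → R) (L : ℤ) (N : ℕ) :
    ℕ → Module.End R ((ℤ → Bool) → R)
  | 0 => 1
  | m + 1 => removeIter r τ y L N m * removeStrip r τ (y m) L N

theorem addStrip_apply_core {r : ℕ} {g : ℤ → Bool}
    (hg : ∀ k : ℤ, ¬(g (k - r) = false ∧ g k = true)) (τ x : R) (L : ℤ) (N : ℕ)
    (v : (ℤ → Bool) → R) : addStrip r τ x L N v g = v g := by
  induction N with
  | zero => rfl
  | succ N ih =>
    have : ¬(g (L + N) = true ∧ g (L + N - r) = false) := fun h => hg _ h.symm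
    simp [addStrip, addRibbon_apply, this, ih]

theorem removeStrip_single_core {r : ℕ} {g : ℤ → Bool}
    (hg : ∀ k : ℤ, ¬(g (k - r) = false ∧ g k = true)) (τ y : R) (L : ℤ) (N : ℕ) :
    removeStrip r τ y L N (Pi.single g 1) = Pi.single g 1 := by
  induction N with
  | zero => rfl
  | succ N ih =>
    have : removeRibbon r τ (L + N) (Pi.single g 1) = 0 := by
      funext t
      rw [removeRibbon_apply]
      split_ifs with h
      · have : hop r (L + N) t ≠ g := by
          rintro rfl
          refine hg (L + N) ?_
          rw [hop_left, hop_right]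
          exact h
        simp [this]
      · rfl
    simp [removeStrip, this, ih]

theorem exists_of_addStrip_ne_zero {r : ℕ} (hr : 1 ≤ r) {τ x : R} {K : ℕ} (hx : x ^ K = 0)
    {L : ℤ} {N : ℕ} {v : (ℤ → Bool) → R} {t : ℤ → Bool} (ht : addStrip r τ x L N v t ≠ 0) :
    ∃ s w, v s ≠ 0 ∧ WitnessIn r L N s t w ∧ ribCount r (bit s) (bit t) ≤ K := by
  rw [addStrip_apply hr τ x L N (g := t) le_rfl le_rfl v (self_mem_box _ _ _)] at ht
  obtain ⟨s, -, hs⟩ := Finset.exists_ne_zero_of_sum_ne_zero ht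
  have h₁ : stripWeight r τ x L N s t ≠ 0 := left_ne_zero_of_mul hs
  simp only [stripWeight] at h₁
  split_ifs at h₁ with hw
  · obtain ⟨w, hw⟩ := hw
    refine ⟨s, w, right_ne_zero_of_mul hs, hw, ?_⟩
    by_contra! hlt
    exact h₁ (by rw [pow_eq_zero_of_le hlt.le hx, zero_mul])
  · exact absurd rfl h₁

theorem addIter_support {r : ℕ} (hr : 1 ≤ r) {τ : R} {x : ℕ → R} {K : ℕ}
    (hx : ∀ i, x i ^ K = 0) {L : ℤ} {N : ℕ} {g : ℤ → Bool} {B : ℤ}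
    (hl : ∀ i < -B, g i = true) (hu : ∀ i, B ≤ i → g i = false) (m : ℕ) {t : ℤ → Bool}
    (ht : addIter r τ x L N g m t ≠ 0) :
    (∀ i < -B - r * m, t i = true) ∧ ∀ i, B + r * K * m ≤ i → t i = false := by
  induction m generalizing t with
  | zero =>
    have : t = g := by
      by_contra h
      exact ht (by simp [addIter, h])
    subst this
    exact ⟨fun i hi => hl i (by simpa using hi), fun i hi => hu i (by simpa using hi)⟩
  | succ m ih =>
    obtain ⟨s, w, hs, hw, hK⟩ := exists_of_addStrip_ne_zero hr (hx m) ht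
    obtain ⟨h₁, h₂⟩ := ih hs
    rw [hw.1.ribCount_eq hr] at hK
    refine ⟨fun i hi => hw.1.eq_true_of_lt h₁ i ?_, fun i hi =>
      hw.1.eq_false_of_le hr h₁ h₂ hK i ?_⟩ <;> push_cast at hi <;> linarith

theorem below_eq_zero {r : ℕ} {t : ℤ → Bool} {i b : ℤ} (h : ∀ k, b ≤ k → t k = false)
    (hb : b ≤ i - r) : below r t i = 0 :=
  Finset.sum_eq_zero fun k hk => by
    rw [Finset.mem_Ico] at hk
    exact bit_eq_zero.2 (h k (by omega))

theorem below_eq_width {r : ℕ} {t : ℤ → Bool} {i a : ℤ} (h : ∀ k < a, t k = true)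
    (ha : i ≤ a) : below r t i = r := by
  rw [below, Finset.sum_congr rfl (g := fun _ => 1)]
  · simp
  · intro k hk
    rw [Finset.mem_Ico] at hk
    exact bit_eq_one.2 (h k (by omega))

theorem removeStrip_addIter {r : ℕ} (hr : 1 ≤ r) {τ y : R} {x : ℕ → R} {K : ℕ}
    (hx : ∀ i, x i ^ K = 0) {f : ℕ → ℕ → R} (hf₀ : ∀ i, f i 0 = 1)
    (hf : ∀ i m, f i (m + 1) = f i m + x i * y * τ ^ (2 * m) * f i (m + 1))
    {L : ℤ} {N : ℕ} {g : ℤ → Bool} (hg : ∀ k : ℤ, ¬(g (k - r) = false ∧ g k = true)) {B : ℤ}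
    (hl : ∀ i < -B, g i = true) (hu : ∀ i, B ≤ i → g i = false) {m : ℕ}
    (hL : L ≤ -B - r * m) (hN : B + r * K * m ≤ L + N - r) :
    removeStrip r τ y L N (addIter r τ x L N g m) =
      (∏ i ∈ Finset.range m, f i r) • addIter r τ x L N g m := by
  induction m with
  | zero => simp [addIter, removeStrip_single_core hg]
  | succ m ih =>
    have e₁ : belowMul r (f m) (L + N) (addIter r τ x L N g (m + 1)) =
        addIter r τ x L N g (m + 1) := by
      funext t
      rw [belowMul_apply]
      by_cases ht : addIter r τ x L N g (m + 1) t = 0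
      · rw [ht, mul_zero]
      · rw [below_eq_zero (addIter_support hr hx hl hu (m + 1) ht).2 (by exact_mod_cast hN), hf₀,
          one_mul]
    have hrm : (r : ℤ) * m ≤ r * (m + 1 : ℕ) := by gcongr; omega
    have hrm' : (r : ℤ) * K * m ≤ r * K * (m + 1 : ℕ) := by gcongr; omega
    have e₂ : belowMul r (f m) L (addIter r τ x L N g m) = f m r • addIter r τ x L N g m := by
      funext t
      rw [belowMul_apply, Pi.smul_apply, smul_eq_mul]
      by_cases ht : addIter r τ x L N g m t = 0
      · rw [ht, mul_zero, mul_zero]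
      · rw [below_eq_width (addIter_support hr hx hl hu m ht).1 (by omega)]
    have key := LinearMap.congr_fun (removeStrip_mul_addStrip hr τ (x m) y (f m) (hf m) L N)
      (addIter r τ x L N g m)
    simp only [Module.End.mul_apply] at key
    rw [← e₁]
    simp only [addIter] at e₁ ⊢
    rw [key, ih (by omega) (by omega), map_smul, e₂, map_smul, map_smul, e₁, smul_smul,
      Finset.prod_range_succ]

theorem removeIter_addIter_apply {r : ℕ} (hr : 1 ≤ r) {τ : R} {x y : ℕ → R} {K : ℕ}
    (hx : ∀ i, x i ^ K = 0) {f : ℕ → ℕ → ℕ → R} (hf₀ : ∀ i j, f i j 0 = 1)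
    (hf : ∀ i j m, f i j (m + 1) = f i j m + x i * y j * τ ^ (2 * m) * f i j (m + 1))
    {L : ℤ} {N : ℕ} {g : ℤ → Bool} (hg : ∀ k : ℤ, ¬(g (k - r) = false ∧ g k = true)) {B : ℤ}
    (hl : ∀ i < -B, g i = true) (hu : ∀ i, B ≤ i → g i = false) {m : ℕ}
    (hL : L ≤ -B - r * m) (hN : B + r * K * m ≤ L + N - r) (n : ℕ) :
    removeIter r τ y L N n (addIter r τ x L N g m) g =
      ∏ j ∈ Finset.range n, ∏ i ∈ Finset.range m, f i j r := by
  have h₁ : ∀ k, addIter r τ x L N g k g = 1 := by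
    intro k
    induction k with
    | zero => simp [addIter]
    | succ k ih => rw [addIter, addStrip_apply_core hg, ih]
  have h₂ : removeIter r τ y L N n (addIter r τ x L N g m) =
      (∏ j ∈ Finset.range n, ∏ i ∈ Finset.range m, f i j r) • addIter r τ x L N g m := by
    induction n with
    | zero => simp [removeIter]
    | succ n ih =>
      rw [removeIter, Module.End.mul_apply,
        removeStrip_addIter hr hx (fun i => hf₀ i n) (fun i => hf i n) hg hl hu hL hN, map_smul, ih,
        smul_smul, Finset.prod_range_succ, mul_comm]
  rw [h₂, Pi.smul_apply, h₁, smul_eq_mul, mul_one]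

end Eigenvector

section Chains

variable {σ : Type*}

/-- The sequences in `S` which start at `g` and are constant from index `m` on. -/
noncomputable def chains (g : σ) (S : Finset σ) : ℕ → Finset (ℕ → σ)
  | 0 => {fun _ => g}
  | m + 1 => (chains g S m ×ˢ S).image fun p i => if i ≤ m then p.1 i else p.2

theorem mem_chains {g : σ} {S : Finset σ} (hg : g ∈ S) {m : ℕ} {c : ℕ → σ} :
    c ∈ chains g S m ↔ c 0 = g ∧ (∀ i, c i ∈ S) ∧ ∀ i, m ≤ i → c i = c m := by
  induction m generalizing c with
  | zero =>
    rw [chains, Finset.mem_singleton]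
    constructor
    · rintro rfl
      exact ⟨rfl, fun _ => hg, fun _ _ => rfl⟩
    · rintro ⟨h₀, -, h⟩
      funext i
      rw [h i (Nat.zero_le i), h₀]
  | succ m ih =>
    simp only [chains, Finset.mem_image, Finset.mem_product, Prod.exists, ih]
    constructor
    · rintro ⟨c, t, ⟨⟨h₀, h₁, h₂⟩, ht⟩, rfl⟩
      refine ⟨by simpa using h₀, fun i => ?_, fun i hi => ?_⟩
      · dsimp only
        split_ifs
        exacts [h₁ i, ht]
      · dsimp only
        rw [if_neg (by omega), if_neg (by omega)]
    · rintro ⟨h₀, h₁, h₂⟩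
      refine ⟨fun i => c (min i m), c (m + 1), ⟨⟨by simpa using h₀, fun i => h₁ _, fun i hi => ?_⟩,
        h₁ _⟩, funext fun i => ?_⟩
      · simp [hi]
      · dsimp only
        split_ifs with hi
        · rw [min_eq_left hi]
        · rw [h₂ i (by omega)]

variable {R : Type*} [CommRing R]

theorem sum_chains_succ {g : σ} {S : Finset σ} (hg : g ∈ S) (W : ℕ → σ → σ → R) (m : ℕ)
    (h : σ → R) :
    ∑ c ∈ chains g S (m + 1), (∏ i ∈ Finset.range (m + 1), W i (c i) (c (i + 1))) * h (c (m + 1)) =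
      ∑ c ∈ chains g S m, (∏ i ∈ Finset.range m, W i (c i) (c (i + 1))) *
        ∑ t ∈ S, W m (c m) t * h t := by
  rw [chains, Finset.sum_image, Finset.sum_product]
  · refine Finset.sum_congr rfl fun c _ => ?_
    rw [Finset.mul_sum]
    refine Finset.sum_congr rfl fun t _ => ?_
    rw [Finset.prod_range_succ, mul_assoc]
    congr 1
    · refine Finset.prod_congr rfl fun i hi => ?_
      rw [Finset.mem_range] at hi
      dsimp only
      rw [if_pos (by omega), if_pos (by omega)]
    · simp
  · rintro ⟨c, t⟩ hc ⟨c', t'⟩ hc' e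
    simp only [Finset.coe_product, Set.mem_prod, Finset.mem_coe, mem_chains hg] at hc hc'
    have e₁ : ∀ i ≤ m, c i = c' i := fun i hi => by simpa [hi] using congrFun e i
    have e₂ : t = t' := by simpa using congrFun e (m + 1)
    rw [Prod.mk.injEq]
    refine ⟨funext fun i => ?_, e₂⟩
    rcases le_total i m with hi | hi
    · exact e₁ i hi
    · rw [hc.1.2.2 i hi, hc'.1.2.2 i hi, e₁ m le_rfl]

end Chains

section Expansion

variable {R : Type*} [CommRing R]

theorem removeIter_apply_eq_sum {r : ℕ} (hr : 1 ≤ r) (τ : R) (y : ℕ → R) {L : ℤ} {N : ℕ}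
    {g : ℤ → Bool} {A B : ℤ} (hA : A ≤ L - r) (hB : L + N ≤ B) (m : ℕ) (v : (ℤ → Bool) → R) :
    removeIter r τ y L N m v g = ∑ c ∈ chains g (box g A B) m,
      (∏ i ∈ Finset.range m, stripWeight r τ (y i) L N (c i) (c (i + 1))) * v (c m) := by
  induction m generalizing v with
  | zero => simp [removeIter, chains]
  | succ m ih =>
    rw [sum_chains_succ (self_mem_box g A B) (fun i => stripWeight r τ (y i) L N), removeIter,
      Module.End.mul_apply, ih]
    refine Finset.sum_congr rfl fun c hc => ?_
    rw [removeStrip_apply hr τ _ L N hA hB v (((mem_chains (self_mem_box g A B)).1 hc).2.1 m)]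

theorem sum_addIter_mul {r : ℕ} (hr : 1 ≤ r) (τ : R) (x : ℕ → R) {L : ℤ} {N : ℕ}
    {g : ℤ → Bool} {A B : ℤ} (hA : A ≤ L - r) (hB : L + N ≤ B) (m : ℕ) (h : (ℤ → Bool) → R) :
    ∑ t ∈ box g A B, addIter r τ x L N g m t * h t = ∑ c ∈ chains g (box g A B) m,
      (∏ i ∈ Finset.range m, stripWeight r τ (x i) L N (c i) (c (i + 1))) * h (c m) := by
  induction m generalizing h with
  | zero => simp [addIter, chains, Pi.single_apply, self_mem_box]
  | succ m ih =>
    rw [sum_chains_succ (self_mem_box g A B) (fun i => stripWeight r τ (x i) L N),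
      ← ih fun s => ∑ t ∈ box g A B, stripWeight r τ (x m) L N s t * h t]
    simp_rw [Finset.mul_sum]
    rw [Finset.sum_comm]
    refine Finset.sum_congr rfl fun t ht => ?_
    rw [addIter, addStrip_apply hr τ _ L N hA hB _ ht, Finset.sum_mul]
    exact Finset.sum_congr rfl fun s _ => by ring

theorem removeIter_addIter_eq_sum {r : ℕ} (hr : 1 ≤ r) (τ : R) (x y : ℕ → R) {L : ℤ} {N : ℕ}
    {g : ℤ → Bool} {A B : ℤ} (hA : A ≤ L - r) (hB : L + N ≤ B) (n : ℕ) :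
    removeIter r τ y L N n (addIter r τ x L N g n) g =
      ∑ p ∈ (chains g (box g A B) n ×ˢ chains g (box g A B) n) with p.1 n = p.2 n,
        (∏ i ∈ Finset.range n, stripWeight r τ (x i) L N (p.1 i) (p.1 (i + 1))) *
          ∏ i ∈ Finset.range n, stripWeight r τ (y i) L N (p.2 i) (p.2 (i + 1)) := by
  rw [removeIter_apply_eq_sum hr τ y hA hB, Finset.sum_filter, Finset.sum_product_right]
  refine Finset.sum_congr rfl fun c hc => ?_
  have := sum_addIter_mul (g := g) hr τ x hA hB n (Pi.single (M := fun _ => R) (c n) 1)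
  simp only [Pi.single_apply, mul_ite, mul_one, mul_zero, Finset.sum_ite_eq',
    ((mem_chains (self_mem_box g A B)).1 hc).2.1 n, if_true] at this
  rw [this, Finset.mul_sum]
  refine Finset.sum_congr rfl fun c' _ => ?_
  split_ifs <;> ring

end Expansion

section Coefficients

theorem map_stripWeight {R R' : Type*} [CommRing R] [CommRing R'] (φ : R →+* R') (r : ℕ) (τ x : R)
    (L : ℤ) (n : ℕ) (s t : ℤ → Bool) :
    φ (stripWeight r τ x L n s t) = stripWeight r (φ τ) (φ x) L n s t := by
  simp only [stripWeight]
  split_ifs <;> simp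

theorem prod_monomial {ι σ R : Type*} [CommSemiring R] (s : Finset ι) (d : ι → σ →₀ ℕ)
    (a : ι → R) : ∏ i ∈ s, MvPolynomial.monomial (d i) (a i) =
      MvPolynomial.monomial (∑ i ∈ s, d i) (∏ i ∈ s, a i) := by
  induction s using Finset.induction_on with
  | empty => simp
  | insert i s hi ih => rw [Finset.prod_insert hi, ih, MvPolynomial.monomial_mul,
      Finset.sum_insert hi, Finset.prod_insert hi]

/-- The first `n` steps of `c` are strips with all ribbons in a given window. -/
def StripsIn (r : ℕ) (L : ℤ) (N n : ℕ) (c : ℕ → ℤ → Bool) : Prop :=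
  ∀ i < n, ∃ w, WitnessIn r L N (c i) (c (i + 1)) w

/-- The total height of the ribbons in the first `n` steps of `c`. -/
noncomputable def totalTwoSpin (r n : ℕ) (c : ℕ → ℤ → Bool) : ℕ :=
  ∑ i ∈ Finset.range n, twoSpin r (bit (c i)) (bit (c (i + 1)))

open Polynomial in
theorem prod_stripWeight {σ : Type*} (r : ℕ) (L : ℤ) (N n : ℕ) (e : ℕ → σ) (c : ℕ → ℤ → Bool) :
    ∏ i ∈ Finset.range n, stripWeight r (MvPolynomial.C (X : ℤ[X]))
      (MvPolynomial.X (e i)) L N (c i) (c (i + 1)) =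
    if StripsIn r L N n c then MvPolynomial.monomial
      (∑ i ∈ Finset.range n, Finsupp.single (e i) (ribCount r (bit (c i)) (bit (c (i + 1)))))
      ((X : ℤ[X]) ^ totalTwoSpin r n c) else 0 := by
  by_cases h : StripsIn r L N n c
  swap
  · rw [if_neg h]
    simp only [StripsIn, not_forall] at h
    obtain ⟨i, hi, h⟩ := h
    exact Finset.prod_eq_zero (Finset.mem_range.2 hi) (if_neg h)
  rw [if_pos h, totalTwoSpin, ← Finset.prod_pow_eq_pow_sum, ← prod_monomial]
  refine Finset.prod_congr rfl fun i hi => ?_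
  rw [stripWeight, if_pos (h i (Finset.mem_range.1 hi)), ← map_pow,
    MvPolynomial.X_pow_eq_monomial, mul_comm, MvPolynomial.C_mul_monomial, mul_one]

/-- The ideal generated by the `K`-th powers of the variables `X (inl i)`. -/
noncomputable def powIdeal (R : Type*) [CommRing R] (K : ℕ) : Ideal (MvPolynomial (ℕ ⊕ ℕ) R) :=
  Ideal.span ((fun s => MvPolynomial.monomial s (1 : R)) ''
    Set.range fun i => Finsupp.single (Sum.inl i) K)

theorem coeff_eq_of_mk_powIdeal_eq {R : Type*} [CommRing R] {K : ℕ}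
    {p q : MvPolynomial (ℕ ⊕ ℕ) R}
    (h : Ideal.Quotient.mk (powIdeal R K) p = Ideal.Quotient.mk (powIdeal R K) q)
    {e : ℕ ⊕ ℕ →₀ ℕ} (he : ∀ i, e (Sum.inl i) < K) : p.coeff e = q.coeff e := by
  rw [Ideal.Quotient.eq, powIdeal, MvPolynomial.mem_ideal_span_monomial_image] at h
  rw [← sub_eq_zero, ← MvPolynomial.coeff_sub]
  by_contra hne
  obtain ⟨_, ⟨i, rfl⟩, hi⟩ := h e (MvPolynomial.mem_support_iff.2 hne)
  have := hi (Sum.inl i)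
  rw [Finsupp.single_eq_same] at this
  exact absurd (he i) (not_lt.2 this)

open Polynomial in
theorem sum_strips_eq_sum_matrices {r : ℕ} (hr : 1 ≤ r) {g : ℤ → Bool}
    (hg : ∀ k : ℤ, ¬(g (k - r) = false ∧ g k = true)) {B : ℤ}
    (hl : ∀ i < -B, g i = true) (hu : ∀ i, B ≤ i → g i = false) {n K : ℕ} {L : ℤ} {N : ℕ}
    (hL : L ≤ -B - r * n) (hN : B + r * K * n ≤ L + N - r) {A U : ℤ} (hA : A ≤ L - r)
    (hU : L + N ≤ U) {e : ℕ ⊕ ℕ →₀ ℕ} (he : ∀ i, e (Sum.inl i) < K) :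
    ∑ p ∈ chains g (box g A U) n ×ˢ chains g (box g A U) n with p.1 n = p.2 n ∧
        StripsIn r L N n p.1 ∧ StripsIn r L N n p.2 ∧
        (∑ i ∈ Finset.range n,
            Finsupp.single (Sum.inl i) (ribCount r (bit (p.1 i)) (bit (p.1 (i + 1))))) +
          (∑ i ∈ Finset.range n,
            Finsupp.single (Sum.inr i) (ribCount r (bit (p.2 i)) (bit (p.2 (i + 1))))) = e,
      (X : ℤ[X]) ^ (totalTwoSpin r n p.1 + totalTwoSpin r n p.2) =
    ∑ a ∈ Fintype.piFinset fun _ : Fin n × Fin n × Fin r => Finset.range K with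
        ∑ q, (Finsupp.single (Sum.inl (q.2.1 : ℕ)) (a q) + Finsupp.single (Sum.inr (q.1 : ℕ)) (a q))
          = e,
      (X : ℤ[X]) ^ (2 * ∑ q, (q.2.2 : ℕ) * a q) := by
  let z : ℕ → ℕ → ℕ → MvPolynomial (ℕ ⊕ ℕ) ℤ[X] := fun i j k =>
    MvPolynomial.X (Sum.inl i) * MvPolynomial.X (Sum.inr j) * MvPolynomial.C X ^ (2 * k)
  let φ := Ideal.Quotient.mk (powIdeal ℤ[X] K)
  have hx : ∀ i, φ (MvPolynomial.X (Sum.inl i)) ^ K = 0 := fun i => by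
    rw [← map_pow, MvPolynomial.X_pow_eq_monomial]
    exact Ideal.Quotient.eq_zero_iff_mem.2 (Ideal.subset_span ⟨_, ⟨i, rfl⟩, rfl⟩)
  have key : φ (∑ p ∈ chains g (box g A U) n ×ˢ chains g (box g A U) n with p.1 n = p.2 n,
        (∏ i ∈ Finset.range n, stripWeight r (MvPolynomial.C (X : ℤ[X]))
          (MvPolynomial.X (Sum.inl i)) L N (p.1 i) (p.1 (i + 1))) *
        ∏ i ∈ Finset.range n, stripWeight r (MvPolynomial.C (X : ℤ[X]))
          (MvPolynomial.X (Sum.inr i)) L N (p.2 i) (p.2 (i + 1))) =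
      φ (∏ j ∈ Finset.range n, ∏ i ∈ Finset.range n, ∏ k ∈ Finset.range r,
        ∑ b ∈ Finset.range K, z i j k ^ b) := by
    simp only [map_sum, map_mul, map_prod, map_stripWeight]
    rw [← removeIter_addIter_eq_sum hr (φ (MvPolynomial.C X))
      (fun i => φ (MvPolynomial.X (Sum.inl i))) (fun i => φ (MvPolynomial.X (Sum.inr i))) hA hU n,
      removeIter_addIter_apply hr hx (f := fun i j m => ∏ k ∈ Finset.range m,
        ∑ b ∈ Finset.range K, φ (z i j k ^ b)) (fun i j => by simp) (fun i j m => ?_)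
        hg hl hu hL hN]
    have hz : (1 - φ (z i j m)) * ∑ b ∈ Finset.range K, φ (z i j m ^ b) = 1 := by
      simp only [map_pow]
      rw [mul_neg_geom_sum]
      simp only [z, map_mul, mul_pow, hx]
      simp
    have hz' : φ (MvPolynomial.X (Sum.inl i)) * φ (MvPolynomial.X (Sum.inr j)) *
        φ (MvPolynomial.C X) ^ (2 * m) = φ (z i j m) := by
      simp only [z, map_mul, map_pow]
    rw [hz', Finset.prod_range_succ]
    linear_combination (∏ k ∈ Finset.range m, ∑ b ∈ Finset.range K, φ (z i j k ^ b)) * hz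
  have key := coeff_eq_of_mk_powIdeal_eq key he
  rw [MvPolynomial.coeff_sum] at key
  convert key using 1
  · rw [Finset.sum_filter, Finset.sum_filter]
    refine Finset.sum_congr rfl fun p _ => ?_
    rw [prod_stripWeight, prod_stripWeight]
    by_cases h₁ : p.1 n = p.2 n <;> by_cases h₂ : StripsIn r L N n p.1 <;>
      by_cases h₃ : StripsIn r L N n p.2 <;>
      simp [h₁, h₂, h₃, MvPolynomial.monomial_mul, MvPolynomial.coeff_monomial, pow_add]
  · have hprod : (∏ j ∈ Finset.range n, ∏ i ∈ Finset.range n, ∏ k ∈ Finset.range r,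
        ∑ b ∈ Finset.range K, z i j k ^ b) =
        ∏ q : Fin n × Fin n × Fin r, ∑ b ∈ Finset.range K, z q.2.1 q.1 q.2.2 ^ b := by
      simp only [Fintype.prod_prod_type, Finset.prod_range]
    rw [hprod, Finset.prod_univ_sum, MvPolynomial.coeff_sum, Finset.sum_filter]
    refine Finset.sum_congr rfl fun a _ => ?_
    have hz : ∀ i j k b, z i j k ^ b = MvPolynomial.monomial
        (Finsupp.single (Sum.inl i) b + Finsupp.single (Sum.inr j) b) (X ^ (2 * (k * b))) := by
      intro i j k b
      simp only [z, mul_pow, MvPolynomial.X_pow_eq_monomial, MvPolynomial.monomial_mul,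
        ← map_pow, ← pow_mul]
      rw [mul_comm, MvPolynomial.C_mul_monomial, mul_one, mul_one, mul_assoc]
    simp only [hz]
    rw [prod_monomial, MvPolynomial.coeff_monomial, Finset.prod_pow_eq_pow_sum, Finset.mul_sum]

end Coefficients

theorem count_map_eq_coeff {ι : Type*} (S : Finset ι) (f : ι → ℕ) (k : ℕ) :
    ((S.val.map f).count k : ℤ) = (∑ i ∈ S, (Polynomial.X : Polynomial ℤ) ^ f i).coeff k := by
  rw [Polynomial.finsetSum_coeff, Multiset.count_map]
  simp only [Polynomial.coeff_X_pow]
  rw [Finset.sum_boole, ← Finset.filter_val]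
  rfl

/-- An identity between sums of powers of `X` with even exponents survives halving. -/
theorem sum_X_pow_half {ι κ : Type*} {S : Finset ι} {T : Finset κ} {f : ι → ℕ} {h : κ → ℕ}
    (e : ∑ i ∈ S, (Polynomial.X : Polynomial ℤ) ^ f i = ∑ j ∈ T, Polynomial.X ^ (2 * h j)) :
    ∑ i ∈ S, (Polynomial.X : Polynomial ℕ) ^ (f i / 2) = ∑ j ∈ T, Polynomial.X ^ h j := by
  have hm : S.val.map f = T.val.map fun j => 2 * h j := Multiset.ext.2 fun k => by
    have := congrArg (fun p => Polynomial.coeff p k) e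
    simp only [← count_map_eq_coeff] at this
    exact_mod_cast this
  have := congrArg (fun m => (m.map fun k => (Polynomial.X : Polynomial ℕ) ^ (k / 2)).sum) hm
  simp only [Multiset.map_map, Function.comp_def] at this
  rw [Finset.sum, this, Finset.sum]
  simp

section Matrices

variable {r n : ℕ} {A : ℕ → ℕ → ℕ → ℕ}

/-- The exponent vector recording the column and row sums of a finite matrix of vectors. -/
noncomputable def marginals (r n : ℕ) (a : Fin n × Fin n × Fin r → ℕ) : ℕ ⊕ ℕ →₀ ℕ :=
  ∑ q, (Finsupp.single (Sum.inl (q.2.1 : ℕ)) (a q) + Finsupp.single (Sum.inr (q.1 : ℕ)) (a q))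

/-- The restriction of a matrix of vectors to finitely many indices. -/
def restrictMatrix (r n : ℕ) (A : ℕ → ℕ → ℕ → ℕ) (q : Fin n × Fin n × Fin r) : ℕ :=
  A q.1 q.2.1 q.2.2

theorem finsum_eq_sum_range {M : Type*} [AddCommMonoid M] {f : ℕ → M} {n : ℕ}
    (h : ∀ i, n ≤ i → f i = 0) :
    ∑ᶠ i, f i = ∑ i ∈ Finset.range n, f i :=
  finsum_eq_sum_of_support_subset _ fun i hi => by
    rw [Finset.coe_range, Set.mem_Iio]
    by_contra! hle
    exact hi (h i hle)

theorem marginals_inl (hA : ∀ i j h, ¬(i < n ∧ j < n ∧ h < r) → A i j h = 0) (j : ℕ) :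
    marginals r n (restrictMatrix r n A) (Sum.inl j) = ∑ᶠ i, vnorm r (A i j) := by
  rw [finsum_eq_sum_range (f := fun i => vnorm r (A i j)) (n := n) fun i hi =>
    Finset.sum_eq_zero fun h _ => hA i j h fun H => absurd H.1 (by omega)]
  simp only [marginals, Finsupp.coe_finsetSum, Finset.sum_apply, Finsupp.add_apply,
    Finsupp.single_apply, Sum.inl.injEq, reduceCtorEq, if_false, add_zero, restrictMatrix,
    Fintype.sum_prod_type, vnorm, Finset.sum_range]
  refine Finset.sum_congr rfl fun i _ => ?_
  rw [Finset.sum_comm]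
  refine Finset.sum_congr rfl fun h _ => ?_
  rw [← Finset.sum_range (fun j' => if j' = j then A i j' h else 0), Finset.sum_ite_eq']
  split_ifs with hj
  · rfl
  · exact (hA _ _ _ fun H => hj (Finset.mem_range.2 H.2.1)).symm

theorem marginals_inr (hA : ∀ i j h, ¬(i < n ∧ j < n ∧ h < r) → A i j h = 0) (i : ℕ) :
    marginals r n (restrictMatrix r n A) (Sum.inr i) = ∑ᶠ j, vnorm r (A i j) := by
  rw [finsum_eq_sum_range (f := fun j => vnorm r (A i j)) (n := n) fun j hj =>
    Finset.sum_eq_zero fun h _ => hA i j h fun H => absurd H.2.1 (by omega)]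
  simp only [marginals, Finsupp.coe_finsetSum, Finset.sum_apply, Finsupp.add_apply,
    Finsupp.single_apply, Sum.inr.injEq, reduceCtorEq, if_false, zero_add, restrictMatrix,
    Fintype.sum_prod_type, vnorm, Finset.sum_range]
  rw [Finset.sum_comm]
  refine Finset.sum_congr rfl fun j _ => ?_
  rw [Finset.sum_comm]
  refine Finset.sum_congr rfl fun h _ => ?_
  rw [← Finset.sum_range (fun i' => if i' = i then A i' j h else 0), Finset.sum_ite_eq']
  split_ifs with hi
  · rfl
  · exact (hA _ _ _ fun H => hi (Finset.mem_range.2 H.1)).symm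

theorem finsum_vcolor (hA : ∀ i j h, ¬(i < n ∧ j < n ∧ h < r) → A i j h = 0) :
    ∑ᶠ i, ∑ᶠ j, vcolor r (A i j) = ∑ q, (q.2.2 : ℕ) * restrictMatrix r n A q := by
  have h₁ : ∀ i, ∑ᶠ j, vcolor r (A i j) = ∑ j ∈ Finset.range n, vcolor r (A i j) := fun i =>
    finsum_eq_sum_range fun j hj => Finset.sum_eq_zero fun h _ => by
      rw [hA i j h fun H => absurd H.2.1 (by omega), mul_zero]
  simp only [h₁]
  rw [finsum_eq_sum_range (f := fun i => ∑ j ∈ Finset.range n, vcolor r (A i j)) (n := n)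
    fun i hi => Finset.sum_eq_zero fun j _ => Finset.sum_eq_zero fun h _ => by
      rw [hA i j h fun H => absurd H.1 (by omega), mul_zero]]
  simp only [vcolor, Finset.sum_range, Fintype.sum_prod_type, restrictMatrix]

theorem vnorm_le_finsum {f : ℕ → ℕ → ℕ} (hf : {i | f i ≠ 0}.Finite) (i : ℕ) :
    vnorm r (f i) ≤ ∑ᶠ i, vnorm r (f i) := by
  refine single_le_finsum (f := fun i => vnorm r (f i)) i (hf.subset fun i hi h => hi ?_)
    fun _ => Nat.zero_le _
  simp [vnorm, h]

theorem le_vnorm {v : ℕ → ℕ} {h : ℕ} (hh : h < r) : v h ≤ vnorm r v :=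
  Finset.single_le_sum (f := v) (fun _ _ => Nat.zero_le _) (Finset.mem_range.2 hh)

theorem finsum_matrices {M : Type*} [AddCommMonoid M] (F : ℕ → M) {K : ℕ} {α β : ℕ →₀ ℕ}
    (hα : ∀ i, n ≤ i → α i = 0) (hβ : ∀ i, n ≤ i → β i = 0) (hK : ∀ i, α i < K) :
    ∑ᶠ A ∈ {A : ℕ → ℕ → ℕ → ℕ |
        (∀ i j, Supported r (A i j)) ∧ {p : ℕ × ℕ | A p.1 p.2 ≠ 0}.Finite ∧
        (∀ j, (∑ᶠ i : ℕ, vnorm r (A i j)) = α j) ∧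
        (∀ i, (∑ᶠ j : ℕ, vnorm r (A i j)) = β i)},
      F (∑ᶠ i : ℕ, ∑ᶠ j : ℕ, vcolor r (A i j)) =
    ∑ a ∈ Fintype.piFinset fun _ : Fin n × Fin n × Fin r => Finset.range K with
        marginals r n a = Finsupp.sumElim α β,
      F (∑ q, (q.2.2 : ℕ) * a q) := by
  have bound : ∀ A : ℕ → ℕ → ℕ → ℕ, ((∀ i j, Supported r (A i j)) ∧
      {p : ℕ × ℕ | A p.1 p.2 ≠ 0}.Finite ∧ (∀ j, (∑ᶠ i : ℕ, vnorm r (A i j)) = α j) ∧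
        (∀ i, (∑ᶠ j : ℕ, vnorm r (A i j)) = β i)) →
      ∀ i j h, A i j h ≤ α j ∧ A i j h ≤ β i := by
    rintro A ⟨h₁, h₂, h₃, h₄⟩ i j h
    by_cases hh : h < r
    · refine ⟨(le_vnorm hh).trans ?_, (le_vnorm hh).trans ?_⟩
      · rw [← h₃ j]
        refine vnorm_le_finsum (f := fun i => A i j) ((h₂.image Prod.fst).subset ?_) i
        exact fun i hi => ⟨(i, j), hi, rfl⟩
      · rw [← h₄ i]
        refine vnorm_le_finsum (f := fun j => A i j) ((h₂.image Prod.snd).subset ?_) j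
        exact fun j hj => ⟨(i, j), hj, rfl⟩
    · rw [h₁ i j h (not_lt.1 hh)]
      exact ⟨Nat.zero_le _, Nat.zero_le _⟩
  have vanish : ∀ A : ℕ → ℕ → ℕ → ℕ, ((∀ i j, Supported r (A i j)) ∧
      {p : ℕ × ℕ | A p.1 p.2 ≠ 0}.Finite ∧ (∀ j, (∑ᶠ i : ℕ, vnorm r (A i j)) = α j) ∧
        (∀ i, (∑ᶠ j : ℕ, vnorm r (A i j)) = β i)) →
      ∀ i j h, ¬(i < n ∧ j < n ∧ h < r) → A i j h = 0 := by
    intro A hA i j h hn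
    have hb := bound A hA i j h
    by_cases hh : h < r
    · by_cases hj : j < n
      · have := hβ i (by omega); omega
      · have := hα j (by omega); omega
    · exact hA.1 i j h (not_lt.1 hh)
  rw [← finsum_mem_coe_finset]
  refine finsum_mem_eq_of_bijOn (restrictMatrix r n) ⟨?_, ?_, ?_⟩ fun A hA => ?_
  · intro A hA
    have hv := vanish A hA
    simp only [Finset.coe_filter, Fintype.mem_piFinset, Finset.mem_range, Set.mem_ofPred_eq]
    refine ⟨fun q => ((bound A hA _ _ _).1).trans_lt (hK _), Finsupp.ext ?_⟩
    rintro (j | i)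
    · rw [marginals_inl hv, hA.2.2.1, Finsupp.sumElim_inl]
    · rw [marginals_inr hv, hA.2.2.2, Finsupp.sumElim_inr]
  · intro A hA A' hA' e
    funext i j h
    by_cases H : i < n ∧ j < n ∧ h < r
    · exact congrFun e (⟨i, H.1⟩, ⟨j, H.2.1⟩, ⟨h, H.2.2⟩)
    · rw [vanish A hA i j h H, vanish A' hA' i j h H]
  · intro a ha
    simp only [Finset.coe_filter, Set.mem_ofPred_eq] at ha
    let A : ℕ → ℕ → ℕ → ℕ := fun i j h =>
      if H : i < n ∧ j < n ∧ h < r then a (⟨i, H.1⟩, ⟨j, H.2.1⟩, ⟨h, H.2.2⟩) else 0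
    have hv : ∀ i j h, ¬(i < n ∧ j < n ∧ h < r) → A i j h = 0 := fun i j h H => dif_neg H
    have hres : restrictMatrix r n A = a := funext fun q => by simp [restrictMatrix, A]
    refine ⟨A, ⟨fun i j h hh => hv i j h fun H => absurd H.2.2 (not_lt.2 hh), ?_, fun j => ?_,
      fun i => ?_⟩, hres⟩
    · refine (Finset.range n ×ˢ Finset.range n).finite_toSet.subset fun p hp => ?_
      rw [Finset.mem_coe, Finset.mem_product, Finset.mem_range, Finset.mem_range]
      by_contra H
      exact hp (funext fun h => hv _ _ _ fun H' => H ⟨H'.1, H'.2.1⟩)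
    · rw [← marginals_inl hv, hres, ha.2, Finsupp.sumElim_inl]
    · rw [← marginals_inr hv, hres, ha.2, Finsupp.sumElim_inr]
  · rw [finsum_vcolor (vanish A hA)]

end Matrices

section Tableaux

variable {r n K : ℕ} {γ : ℕ → ℕ} {B L A U : ℤ} {N : ℕ}

theorem _root_.IsSSRT.edge_bounds (hr : 1 ≤ r) {c : ℕ → ℕ → ℕ} (hc : IsSSRT r γ c)
    (hl : ∀ i < -B, edge γ i = true) (hu : ∀ i, B ≤ i → edge γ i = false)
    (hK : ∀ i, chainWt r c i ≤ K) (m : ℕ) :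
    (∀ i < -B - r * m, edge (c m) i = true) ∧
      ∀ i, B + r * K * m ≤ i → edge (c m) i = false := by
  induction m with
  | zero =>
    rw [hc.1]
    exact ⟨fun i hi => hl i (by simpa using hi), fun i hi => hu i (by simpa using hi)⟩
  | succ m ih =>
    obtain ⟨h₁, h₂⟩ := ih
    obtain ⟨w, hw⟩ := hc.2.2 m
    have hk := hK m
    rw [chainWt, hw.ribCount_eq hr] at hk
    simp only [← bit_edge] at hw hk
    refine ⟨fun i hi => hw.eq_true_of_lt h₁ i ?_, fun i hi =>
      hw.eq_false_of_le hr h₁ h₂ hk i ?_⟩ <;> push_cast at hi <;> linarith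

theorem _root_.IsSSRT.succ_eq_of_chainWt_eq_zero (hr : 1 ≤ r) {c : ℕ → ℕ → ℕ}
    (hc : IsSSRT r γ c) {i : ℕ} (h : chainWt r c i = 0) : c (i + 1) = c i := by
  obtain ⟨w, hw⟩ := hc.2.2 i
  rw [chainWt, hw.ribCount_eq hr, Set.ncard_eq_zero hw.2] at h
  refine (edge_injective (hc.2.1 _) (hc.2.1 _) (bit_injective ?_)).symm
  rw [bit_edge, bit_edge]
  exact hw.eq_of_not_quad fun k hk => (h ▸ hk : k ∈ (∅ : Set ℤ))

theorem _root_.IsSSRT.eq_of_le (hr : 1 ≤ r) {c : ℕ → ℕ → ℕ} (hc : IsSSRT r γ c)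
    (hn : ∀ i, n ≤ i → chainWt r c i = 0) {i : ℕ} (hi : n ≤ i) : c i = c n := by
  induction i, hi using Nat.le_induction with
  | base => rfl
  | succ i hi ih => rw [hc.succ_eq_of_chainWt_eq_zero hr (hn i hi), ih]

theorem _root_.IsSSRT.chainTwoSpin_eq (hr : 1 ≤ r) {c : ℕ → ℕ → ℕ} (hc : IsSSRT r γ c)
    (hn : ∀ i, n ≤ i → chainWt r c i = 0) :
    chainTwoSpin r c = totalTwoSpin r n fun i => edge (c i) := by
  rw [chainTwoSpin, finsum_eq_sum_range (n := n) fun i hi => by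
    rw [hc.succ_eq_of_chainWt_eq_zero hr (hn i hi), twoSpin_self hr]]
  simp only [totalTwoSpin, bit_edge]

theorem _root_.IsSSRT.stripsIn (hr : 1 ≤ r) {c : ℕ → ℕ → ℕ} (hc : IsSSRT r γ c)
    (hl : ∀ i < -B, edge γ i = true) (hu : ∀ i, B ≤ i → edge γ i = false)
    (hL : L ≤ -B - r * n) (hN : B + r * K * n ≤ L + N - r) (hK : ∀ i, chainWt r c i ≤ K) :
    StripsIn r L N n fun i => edge (c i) := by
  intro i hi
  obtain ⟨w, hw⟩ := hc.2.2 i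
  have hk := hK i
  rw [chainWt, hw.ribCount_eq hr] at hk
  obtain ⟨h₁, h₂⟩ := hc.edge_bounds hr hl hu hK i
  simp only [← bit_edge] at hw hk
  refine ⟨w, hw, fun k hq => ?_⟩
  obtain ⟨h₃, h₄⟩ := hw.quad_bounds hr h₁ h₂ hk hq
  have e₁ : (r : ℤ) * i ≤ r * n := by gcongr
  have e₂ : (r : ℤ) * K * (i + 1) ≤ r * K * n := by gcongr; omega
  exact ⟨by linarith, by linarith⟩

theorem _root_.IsSSRT.edge_mem_chains (hr : 1 ≤ r) {c : ℕ → ℕ → ℕ} (hc : IsSSRT r γ c)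
    (hl : ∀ i < -B, edge γ i = true) (hu : ∀ i, B ≤ i → edge γ i = false)
    (hL : L ≤ -B - r * n) (hN : B + r * K * n ≤ L + N - r) (hA : A ≤ L - r) (hU : L + N ≤ U)
    (hn : ∀ i, n ≤ i → chainWt r c i = 0) (hK : ∀ i, chainWt r c i ≤ K) :
    (fun i => edge (c i)) ∈ chains (edge γ) (box (edge γ) A U) n := by
  have h : ∀ i ≤ n, edge (c i) ∈ box (edge γ) A U := fun i hi => mem_box.2 fun p hp => by
    obtain ⟨h₁, h₂⟩ := hc.edge_bounds hr hl hu hK i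
    have e₁ : (r : ℤ) * i ≤ r * n := by gcongr
    have e₂ : (r : ℤ) * K * i ≤ r * K * n := by gcongr
    have e₃ : (0 : ℤ) ≤ r * i := by positivity
    have e₄ : (0 : ℤ) ≤ r * K * i := by positivity
    rw [Finset.mem_Ico, not_and_or, not_le, not_lt] at hp
    rcases hp with hp | hp
    · rw [h₁ p (by linarith), hl p (by linarith)]
    · rw [h₂ p (by linarith), hu p (by linarith)]
  refine (mem_chains (self_mem_box _ _ _)).2 ⟨congrArg edge hc.1, fun i => ?_,
    fun i hi => congrArg edge (hc.eq_of_le hr hn hi)⟩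
  rcases le_total i n with hi | hi
  · exact h i hi
  · rw [hc.eq_of_le hr hn hi]
    exact h n le_rfl

theorem exists_isSSRT (hr : 1 ≤ r) (hγ : IsPartition γ) {α : ℕ → ℕ} (hα : ∀ i, n ≤ i → α i = 0)
    {c : ℕ → ℤ → Bool} (hc : c ∈ chains (edge γ) (box (edge γ) A U) n)
    (hs : StripsIn r L N n c)
    (hw : ∀ i < n, ribCount r (bit (c i)) (bit (c (i + 1))) = α i) :
    ∃ d, IsSSRT r γ d ∧ (fun i => edge (d i)) = c ∧ ∀ i, chainWt r d i = α i := by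
  obtain ⟨h₀, -, h₂⟩ := (mem_chains (self_mem_box _ _ _)).1 hc
  have h₃ : ∀ i, ∃ f, IsPartition f ∧ edge f = c i := by
    intro i
    induction i with
    | zero => exact ⟨γ, hγ, h₀.symm⟩
    | succ i ih =>
      rcases lt_or_ge i n with hi | hi
      · obtain ⟨f, hf, e⟩ := ih
        obtain ⟨w, hw⟩ := hs i hi
        rw [← e] at hw
        exact hw.exists_edge hr hf
      · rw [h₂ (i + 1) (by omega), ← h₂ i hi]
        exact ih
  choose d hd he using h₃
  refine ⟨d, ⟨edge_injective (hd 0) hγ ((he 0).trans h₀), hd, fun i => ?_⟩, funext he,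
    fun i => ?_⟩
  · rw [← bit_edge, ← bit_edge, he, he]
    rcases lt_or_ge i n with hi | hi
    · obtain ⟨w, hw⟩ := hs i hi
      exact ⟨w, hw.1⟩
    · rw [h₂ (i + 1) (by omega), h₂ i hi]
      exact ⟨_, isWitness_self r _⟩
  · rw [chainWt, ← bit_edge, ← bit_edge, he, he]
    rcases lt_or_ge i n with hi | hi
    · exact hw i hi
    · rw [h₂ (i + 1) (by omega), h₂ i hi, ribCount_self hr, hα i hi]

theorem sum_single_eq_sumElim_iff {u v : ℕ → ℕ} {α β : ℕ →₀ ℕ} (hα : ∀ i, n ≤ i → α i = 0)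
    (hβ : ∀ i, n ≤ i → β i = 0) :
    (∑ i ∈ Finset.range n, Finsupp.single (Sum.inl i) (u i)) +
        ∑ i ∈ Finset.range n, Finsupp.single (Sum.inr i) (v i) = Finsupp.sumElim α β ↔
      (∀ i < n, u i = α i) ∧ ∀ i < n, v i = β i := by
  rw [DFunLike.ext_iff, Sum.forall]
  simp only [Finsupp.add_apply, Finsupp.coe_finsetSum, Finset.sum_apply, Finsupp.single_apply,
    Sum.inl.injEq, Sum.inr.injEq, reduceCtorEq, if_false, Finset.sum_const_zero, add_zero,
    zero_add, Finset.sum_ite_eq', Finset.mem_range, Finsupp.sumElim_inl, Finsupp.sumElim_inr]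
  refine and_congr (forall_congr' fun i => ?_) (forall_congr' fun i => ?_)
  · split_ifs with h
    · simp [h]
    · simp [h, hα i (not_lt.1 h)]
  · split_ifs with h
    · simp [h]
    · simp [h, hβ i (not_lt.1 h)]

theorem finsum_tableaux {M : Type*} [AddCommMonoid M] (F : ℕ → M) (hr : 1 ≤ r)
    (hγ : IsPartition γ) (hl : ∀ i < -B, edge γ i = true) (hu : ∀ i, B ≤ i → edge γ i = false)
    (hL : L ≤ -B - r * n) (hN : B + r * K * n ≤ L + N - r) (hA : A ≤ L - r) (hU : L + N ≤ U)
    {α β : ℕ →₀ ℕ} (hα : ∀ i, n ≤ i → α i = 0) (hβ : ∀ i, n ≤ i → β i = 0)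
    (hα' : ∀ i, α i ≤ K) (hβ' : ∀ i, β i ≤ K) :
    ∑ᶠ PQ ∈ {PQ : (ℕ → ℕ → ℕ) × (ℕ → ℕ → ℕ) |
        IsSSRT r γ PQ.1 ∧ IsSSRT r γ PQ.2 ∧
        (∀ i, chainWt r PQ.1 i = α i) ∧ (∀ i, chainWt r PQ.2 i = β i) ∧
        ∃ N : ℕ, ∀ i : ℕ, N ≤ i → PQ.1 i = PQ.2 i},
      F (chainTwoSpin r PQ.1 + chainTwoSpin r PQ.2) =
    ∑ p ∈ chains (edge γ) (box (edge γ) A U) n ×ˢ chains (edge γ) (box (edge γ) A U) n with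
        p.1 n = p.2 n ∧ StripsIn r L N n p.1 ∧ StripsIn r L N n p.2 ∧
        (∑ i ∈ Finset.range n,
            Finsupp.single (Sum.inl i) (ribCount r (bit (p.1 i)) (bit (p.1 (i + 1))))) +
          (∑ i ∈ Finset.range n,
            Finsupp.single (Sum.inr i) (ribCount r (bit (p.2 i)) (bit (p.2 (i + 1))))) =
          Finsupp.sumElim α β,
      F (totalTwoSpin r n p.1 + totalTwoSpin r n p.2) := by
  have zero_of : ∀ {c : ℕ → ℕ → ℕ} {δ : ℕ →₀ ℕ}, (∀ i, n ≤ i → δ i = 0) →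
      (∀ i, chainWt r c i = δ i) → ∀ i, n ≤ i → chainWt r c i = 0 :=
    fun hδ h i hi => (h i).trans (hδ i hi)
  rw [← finsum_mem_coe_finset]
  refine finsum_mem_eq_of_bijOn (fun PQ => (fun i => edge (PQ.1 i), fun i => edge (PQ.2 i)))
    ⟨?_, ?_, ?_⟩ fun PQ hPQ => ?_
  · rintro ⟨P, Q⟩ ⟨hP, hQ, wP, wQ, m, hm⟩
    simp only [Finset.coe_filter, Set.mem_ofPred_eq, Finset.mem_product] at hP hQ wP wQ hm ⊢
    have zP := zero_of hα wP
    have zQ := zero_of hβ wQ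
    have kP : ∀ i, chainWt r P i ≤ K := fun i => (wP i).trans_le (hα' i)
    have kQ : ∀ i, chainWt r Q i ≤ K := fun i => (wQ i).trans_le (hβ' i)
    refine ⟨⟨hP.edge_mem_chains hr hl hu hL hN hA hU zP kP,
      hQ.edge_mem_chains hr hl hu hL hN hA hU zQ kQ⟩, ?_, hP.stripsIn hr hl hu hL hN kP,
      hQ.stripsIn hr hl hu hL hN kQ, (sum_single_eq_sumElim_iff hα hβ).2 ⟨fun i _ => ?_,
      fun i _ => ?_⟩⟩
    · rw [← hP.eq_of_le hr zP (le_max_left n m), ← hQ.eq_of_le hr zQ (le_max_left n m),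
        hm _ (le_max_right n m)]
    · rw [bit_edge, bit_edge]; exact wP i
    · rw [bit_edge, bit_edge]; exact wQ i
  · rintro ⟨P, Q⟩ ⟨hP, hQ, -⟩ ⟨P', Q'⟩ ⟨hP', hQ', -⟩ e
    rw [Prod.mk.injEq] at e ⊢
    exact ⟨funext fun i => edge_injective (hP.2.1 i) (hP'.2.1 i) (congrFun e.1 i),
      funext fun i => edge_injective (hQ.2.1 i) (hQ'.2.1 i) (congrFun e.2 i)⟩
  · rintro ⟨c, c'⟩ h
    simp only [Finset.coe_filter, Set.mem_ofPred_eq, Finset.mem_product] at h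
    obtain ⟨⟨hc, hc'⟩, hn, hs, hs', he⟩ := h
    obtain ⟨h₁, h₂⟩ := (sum_single_eq_sumElim_iff hα hβ).1 he
    obtain ⟨P, hP, eP, wP⟩ := exists_isSSRT hr hγ hα hc hs h₁
    obtain ⟨Q, hQ, eQ, wQ⟩ := exists_isSSRT hr hγ hβ hc' hs' h₂
    refine ⟨(P, Q), ⟨hP, hQ, wP, wQ, n, fun i hi => ?_⟩, Prod.ext eP eQ⟩
    have : edge (P n) = edge (Q n) := (congrFun eP n).trans (hn.trans (congrFun eQ n).symm)
    dsimp only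
    rw [hP.eq_of_le hr (zero_of hα wP) hi, hQ.eq_of_le hr (zero_of hβ wQ) hi]
    exact edge_injective (hP.2.1 n) (hQ.2.1 n) this
  · obtain ⟨hP, hQ, wP, wQ, -⟩ := hPQ
    rw [hP.chainTwoSpin_eq hr (zero_of hα wP), hQ.chainTwoSpin_eq hr (zero_of hβ wQ)]

end Tableaux

end RibbonStrip

/-- The `q`-analogue of the `r`-fold Cauchy identity
`Σ_λ G_λ(q^{1/2},X) G_λ(q^{1/2},Y) = Π_{i,j} Π_{k<r} 1/(1 - q^k X_i Y_j)`, stated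
coefficientwise: for every pair of exponent vectors `α, β`, the coefficient of
`X^α Y^β` on the left (a sum of `q^{spin P + spin Q}` over pairs of semistandard
`r`-ribbon tableaux of equal shape with weights `α` and `β`) equals the coefficient on
the right (a sum of `q^{Σ n(A_{ij})}` over matrices `A` with entries in `ℕʳ` whose
column sums of `|·|` are `α` and row sums are `β`). -/
theorem stmt15 (r : ℕ) (hr : 1 ≤ r) (γ : ℕ → ℕ) (hγ : IsPartition γ)
    (hcore : ∀ k : ℤ, ¬(edgeSeq γ (k - r) = 0 ∧ edgeSeq γ k = 1))
    (α β : ℕ →₀ ℕ) :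
    (∑ᶠ PQ ∈ {PQ : (ℕ → ℕ → ℕ) × (ℕ → ℕ → ℕ) |
        IsSSRT r γ PQ.1 ∧ IsSSRT r γ PQ.2 ∧
        (∀ i, chainWt r PQ.1 i = α i) ∧ (∀ i, chainWt r PQ.2 i = β i) ∧
        ∃ N : ℕ, ∀ i : ℕ, N ≤ i → PQ.1 i = PQ.2 i},
      (Polynomial.X : Polynomial ℕ) ^ ((chainTwoSpin r PQ.1 + chainTwoSpin r PQ.2) / 2))
    = ∑ᶠ A ∈ {A : ℕ → ℕ → ℕ → ℕ |
        (∀ i j, Supported r (A i j)) ∧ {p : ℕ × ℕ | A p.1 p.2 ≠ 0}.Finite ∧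
        (∀ j, (∑ᶠ i : ℕ, vnorm r (A i j)) = α j) ∧
        (∀ i, (∑ᶠ j : ℕ, vnorm r (A i j)) = β i)},
      (Polynomial.X : Polynomial ℕ) ^ (∑ᶠ i : ℕ, ∑ᶠ j : ℕ, vcolor r (A i j)) := by
  have hg : ∀ k : ℤ, ¬(RibbonStrip.edge γ (k - r) = false ∧ RibbonStrip.edge γ k = true) :=
    fun k h => hcore k <| by
      rw [← RibbonStrip.bit_edge, RibbonStrip.bit_eq_zero, RibbonStrip.bit_eq_one]
      exact h
  obtain ⟨B, hl, hu⟩ := hγ.exists_bound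
  obtain ⟨n, hn⟩ := (α.support ∪ β.support).exists_nat_subset_range
  have hα : ∀ i, n ≤ i → α i = 0 := fun i hi => by
    by_contra h
    exact absurd (Finset.mem_range.1 (hn (Finset.mem_union_left _ (Finsupp.mem_support_iff.2 h))))
      (not_lt.2 hi)
  have hβ : ∀ i, n ≤ i → β i = 0 := fun i hi => by
    by_contra h
    exact absurd (Finset.mem_range.1 (hn (Finset.mem_union_right _ (Finsupp.mem_support_iff.2 h))))
      (not_lt.2 hi)
  obtain ⟨K, hK⟩ : ∃ K, ∀ i, α i < K ∧ β i < K := by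
    refine ⟨∑ i ∈ Finset.range n, (α i + β i) + 1, fun i => ?_⟩
    rcases lt_or_ge i n with hi | hi
    · have := Finset.single_le_sum (f := fun i => α i + β i) (fun _ _ => Nat.zero_le _)
        (Finset.mem_range.2 hi)
      omega
    · rw [hα i hi, hβ i hi]
      omega
  obtain ⟨L, hL⟩ : ∃ L : ℤ, L = -B - r * n := ⟨_, rfl⟩
  obtain ⟨N, hN⟩ : ∃ N : ℕ, N = 2 * B + r * n + r * K * n + r := ⟨_, rfl⟩
  have hN' : (B : ℤ) + r * K * n ≤ L + N - r := by
    rw [hL, hN]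
    push_cast
    linarith
  rw [RibbonStrip.finsum_tableaux (fun k => (Polynomial.X : Polynomial ℕ) ^ (k / 2)) hr hγ hl hu
      hL.le hN' le_rfl le_rfl hα hβ (fun i => (hK i).1.le) fun i => (hK i).2.le,
    RibbonStrip.finsum_matrices (fun k => (Polynomial.X : Polynomial ℕ) ^ k) hα hβ
      fun i => (hK i).1]
  exact RibbonStrip.sum_X_pow_half (RibbonStrip.sum_strips_eq_sum_matrices hr hg hl hu hL.le hN'
    le_rfl le_rfl fun i => (hK i).1)
end
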